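/- arXiv:1401.3115 — 5 statements merged into one kernel-verified Lean document; each statement's English description precedes it below -/
import Mathlib

section
/- For every a ∈ ℝ \ {0}, every t > 0 and every x with 0 < x < t, one has |φ_a(x,t)| ≤ |φ_0(x,t)|; in particular the function x ↦ φ_a(x,t)/φ_0(x,t) is bounded by 1 in absolute value on the open interval (0,t). -/
open Real Filter

/-- For `a ≠ 0`, the function `φ_a(x,t) = (π / sinh(aπ)) Σ_{k ∈ ℤ} sin(ax + 2kat) e^{−2(kx + k²t)}`. -/
noncomputable def phi (a x t : ℝ) : ℝ :=
  (Real.pi / Real.sinh (a * Real.pi)) *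
    ∑' k : ℤ, Real.sin (a * x + 2 * (k : ℝ) * a * t) * Real.exp (-2 * ((k : ℝ) * x + (k : ℝ) ^ 2 * t))

/-- The function `φ_0(x,t) = Σ_{k ∈ ℤ} (x + 2kt) e^{−2(kx + k²t)}`. -/
noncomputable def phi0 (x t : ℝ) : ℝ :=
  ∑' k : ℤ, (x + 2 * (k : ℝ) * t) * Real.exp (-2 * ((k : ℝ) * x + (k : ℝ) ^ 2 * t))

/-- `φ_a` for all `a ∈ ℝ`, with `φ_0` as the value at `a = 0`. -/
noncomputable def phiA (a x t : ℝ) : ℝ := if a = 0 then phi0 x t else phi a x t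

open MeasureTheory

lemma prod_Ico_add_one_mul (f : ℤ → ℝ) {a b : ℤ} (h : a ≤ b) :
    (∏ j ∈ Finset.Ico a b, f (j + 1)) * f a = (∏ j ∈ Finset.Ico a b, f j) * f b := by
  induction b, h using Int.leInduction with
  | base => simp
  | succ n hn ih =>
    have h1 : Finset.Ico a (n + 1) = insert n (Finset.Ico a n) := by
      ext i; simp only [Finset.mem_Ico, Finset.mem_insert]; omega
    rw [h1, Finset.prod_insert (by simp), Finset.prod_insert (by simp), mul_assoc, ih]
    ring

lemma sinh_div_sinh_le_exp {a b : ℝ} (hb : 0 < b) (hab : a ≤ b) :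
    sinh a / sinh b ≤ exp (a - b) := by
  rw [div_le_iff₀ (sinh_pos_iff.2 hb), sinh_eq, sinh_eq]
  have h1 : exp (a - b) * exp b = exp a := by rw [← exp_add]; ring_nf
  have h2 : exp (a - b) * exp (-b) ≤ exp (-a) := by
    rw [← exp_add]; exact exp_le_exp.2 (by linarith)
  linarith

lemma exp_le_sinh_div_sinh {a b : ℝ} (hb : 0 < b) (hab : b ≤ a) :
    exp (a - b) ≤ sinh a / sinh b := by
  rw [le_div_iff₀ (sinh_pos_iff.2 hb), sinh_eq, sinh_eq]
  have h1 : exp (a - b) * exp b = exp a := by rw [← exp_add]; ring_nf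
  have h2 : exp (-a) ≤ exp (a - b) * exp (-b) := by
    rw [← exp_add]; exact exp_le_exp.2 (by linarith)
  linarith

lemma tendsto_sinh_div_sinh (α β : ℝ) :
    Tendsto (fun v => sinh (v + α) / sinh (v + β)) atTop (nhds (exp (α - β))) := by
  have hE : Tendsto (fun v : ℝ => exp (-(2 * v))) atTop (nhds 0) :=
    tendsto_exp_neg_atTop_nhds_zero.comp (tendsto_id.const_mul_atTop two_pos)
  have h : Tendsto (fun v : ℝ => (exp α - exp (-(2 * v)) * exp (-α)) /
      (exp β - exp (-(2 * v)) * exp (-β))) atTop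
      (nhds ((exp α - 0 * exp (-α)) / (exp β - 0 * exp (-β)))) :=
    ((tendsto_const_nhds.sub (hE.mul_const _))).div (tendsto_const_nhds.sub (hE.mul_const _))
      (by simp)
  have he : (exp α - 0 * exp (-α)) / (exp β - 0 * exp (-β)) = exp (α - β) := by
    rw [exp_sub]; ring
  rw [he] at h
  refine h.congr fun v => ?_
  have key (γ : ℝ) : sinh (v + γ) = exp v / 2 * (exp γ - exp (-(2 * v)) * exp (-γ)) := by
    have : exp (-(v + γ)) = exp v * (exp (-(2 * v)) * exp (-γ)) := by
      rw [← exp_add, ← exp_add]; ring_nf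
    rw [sinh_eq, this, exp_add]; ring
  rw [key, key, mul_div_mul_left _ _ (by positivity)]

/-- `sinh (m t)`, with the value at `m = 0` replaced by `1`. -/
noncomputable def sinhMulOrOne (t : ℝ) (m : ℤ) : ℝ := if m = 0 then 1 else sinh (m * t)

/-- The product `∏_j sinh (x + (j + k) t) sinh ((j - k) t)` over `-N - 1 ≤ j ≤ N`, where the
vanishing factor `sinh 0` is replaced by `1`. -/
noncomputable def sinhProd (x t : ℝ) (N : ℕ) (k : ℤ) : ℝ :=
  ∏ j ∈ Finset.Ico (-N - 1 : ℤ) (N + 1), (sinh (x + (j + k : ℤ) * t) * sinhMulOrOne t (j - k))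

lemma sinhMulOrOne_ne_zero {t : ℝ} (ht : 0 < t) (m : ℤ) : sinhMulOrOne t m ≠ 0 := by
  unfold sinhMulOrOne
  split_ifs with h
  · exact one_ne_zero
  · simp [sinh_eq_zero, h, ht.ne']

lemma sinh_add_int_mul_pos {x t : ℝ} (ht : 0 < t) (hx : 0 < x) {m : ℤ} (hm : 0 ≤ m) :
    0 < sinh (x + m * t) := by
  have : (0 : ℝ) ≤ m := by exact_mod_cast hm
  exact sinh_pos_iff.2 (by positivity)

lemma sinh_add_int_mul_neg {x t : ℝ} (ht : 0 < t) (hxt : x < t) {m : ℤ} (hm : m < 0) :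
    sinh (x + m * t) < 0 := by
  have : (m : ℝ) ≤ -1 := by exact_mod_cast (by omega : m ≤ -1)
  exact sinh_neg_iff.2 (by nlinarith)

lemma sinh_add_int_mul_ne_zero {x t : ℝ} (ht : 0 < t) (hx : 0 < x) (hxt : x < t) (m : ℤ) :
    sinh (x + m * t) ≠ 0 := by
  rcases le_or_gt 0 m with h | h
  · exact (sinh_add_int_mul_pos ht hx h).ne'
  · exact (sinh_add_int_mul_neg ht hxt h).ne

lemma sinhProd_ne_zero {x t : ℝ} (ht : 0 < t) (hx : 0 < x) (hxt : x < t) (N : ℕ) (k : ℤ) :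
    sinhProd x t N k ≠ 0 :=
  Finset.prod_ne_zero_iff.2 fun _ _ =>
    mul_ne_zero (sinh_add_int_mul_ne_zero ht hx hxt _) (sinhMulOrOne_ne_zero ht _)

lemma sinhProd_zero_pos {x t : ℝ} (ht : 0 < t) (hx : 0 < x) (hxt : x < t) (N : ℕ) :
    0 < sinhProd x t N 0 := by
  refine Finset.prod_pos fun j _ => ?_
  simp only [add_zero, sub_zero, sinhMulOrOne]
  rcases lt_trichotomy j 0 with h | h | h
  · rw [if_neg h.ne]
    refine mul_pos_of_neg_of_neg (sinh_add_int_mul_neg ht hxt h) (sinh_neg_iff.2 ?_)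
    exact mul_neg_of_neg_of_pos (by exact_mod_cast h) ht
  · simpa [h] using hx
  · rw [if_neg h.ne']
    refine mul_pos (sinh_add_int_mul_pos ht hx h.le) (sinh_pos_iff.2 ?_)
    exact mul_pos (by exact_mod_cast h) ht

lemma sinhProd_succ (x t : ℝ) (N : ℕ) (k : ℤ) :
    sinhProd x t N (k + 1) *
        (sinh (x + (k - N - 1 : ℤ) * t) * sinhMulOrOne t (N - k)) =
      sinhProd x t N k *
        (sinh (x + (N + k + 1 : ℤ) * t) * sinhMulOrOne t (-N - 2 - k)) := by
  have h1 := prod_Ico_add_one_mul (fun j => sinh (x + (j + k : ℤ) * t))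
    (show (-N - 1 : ℤ) ≤ N + 1 by omega)
  have h2 := prod_Ico_add_one_mul (fun j => sinhMulOrOne t (j - (k + 1)))
    (show (-N - 1 : ℤ) ≤ N + 1 by omega)
  simp only [show ∀ j : ℤ, j + 1 + k = j + (k + 1) by intro j; ring,
    show (-N - 1 + k : ℤ) = k - N - 1 by ring, ← add_assoc (N : ℤ)] at h1
  simp only [show ∀ j : ℤ, j + 1 - (k + 1) = j - k by intro j; ring,
    show (-N - 1 - (k + 1) : ℤ) = -N - 2 - k by ring] at h2
  simp only [sinhProd, Finset.prod_mul_distrib]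
  rw [mul_mul_mul_comm, h1, ← h2]
  ring

/-- The ratio `sinhProd x t N k / sinhProd x t N (k + 1)` for `-N - 2 < k < N`. -/
noncomputable def sinhRatio (x t : ℝ) (N : ℕ) (k : ℤ) : ℝ :=
  (sinh ((N - k) * t) / sinh ((N + k + 2) * t)) *
    (sinh ((N + 1 - k) * t - x) / sinh ((N + 1 + k) * t + x))

lemma sinhProd_div_succ {x t : ℝ} (ht : 0 < t) (hx : 0 < x) (hxt : x < t) {N : ℕ} {k : ℤ}
    (h1 : -N - 2 < k) (h2 : k < N) :
    sinhProd x t N 0 / sinhProd x t N (k + 1) =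
      sinhProd x t N 0 / sinhProd x t N k * sinhRatio x t N k := by
  have h := sinhProd_succ x t N k
  have e1 := sinhProd_ne_zero ht hx hxt N k
  have e2 := sinhProd_ne_zero ht hx hxt N (k + 1)
  have f1 := sinh_add_int_mul_ne_zero ht hx hxt (N + k + 1)
  have f2 := sinhMulOrOne_ne_zero ht (-N - 2 - k)
  have hρ : sinhRatio x t N k = (sinh (x + (k - N - 1 : ℤ) * t) * sinhMulOrOne t (N - k)) /
      (sinh (x + (N + k + 1 : ℤ) * t) * sinhMulOrOne t (-N - 2 - k)) := by
    unfold sinhRatio sinhMulOrOne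
    rw [if_neg (by omega), if_neg (by omega)]
    push_cast
    rw [show (x + ((k : ℝ) - N - 1) * t) = -((N + 1 - k) * t - x) by ring,
      show (-(N : ℝ) - 2 - k) * t = -((N + k + 2) * t) by ring,
      show x + ((N : ℝ) + k + 1) * t = (N + 1 + k) * t + x by ring, sinh_neg, sinh_neg]
    rw [div_mul_div_comm, mul_neg, neg_mul, neg_div_neg_eq]
    ring
  rw [hρ, div_mul_div_comm, div_eq_div_iff e2 (mul_ne_zero e1 (mul_ne_zero f1 f2))]
  linear_combination -(sinhProd x t N 0) * h

lemma sinhRatio_pos {x t : ℝ} (ht : 0 < t) (hx : 0 < x) (hxt : x < t) {N : ℕ} {k : ℤ}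
    (h1 : -N - 1 ≤ k) (h2 : k < N) : 0 < sinhRatio x t N k := by
  have h1' : (-N - 1 : ℝ) ≤ k := by exact_mod_cast h1
  have h2' : (k : ℝ) + 1 ≤ N := by exact_mod_cast h2
  unfold sinhRatio
  refine mul_pos (div_pos ?_ ?_) (div_pos ?_ ?_) <;> refine sinh_pos_iff.2 ?_ <;> nlinarith

/-- The weight `e^{-2(kx + k²t)}`. -/
noncomputable def gaussWeight (x t : ℝ) (k : ℤ) : ℝ := exp (-2 * ((k : ℝ) * x + (k : ℝ) ^ 2 * t))

lemma gaussWeight_succ (x t : ℝ) (k : ℤ) :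
    gaussWeight x t (k + 1) = gaussWeight x t k * exp (-2 * x - 2 * (2 * k + 1) * t) := by
  unfold gaussWeight
  rw [← exp_add]
  push_cast
  ring_nf

lemma sinhRatio_le {x t : ℝ} (ht : 0 < t) (hx : 0 < x) (hxt : x < t) {N : ℕ} {k : ℤ}
    (h1 : 0 ≤ k) (h2 : k < N) : sinhRatio x t N k ≤ exp (-2 * x - 2 * (2 * k + 1) * t) := by
  have h1' : (0 : ℝ) ≤ k := by exact_mod_cast h1
  have h2' : (k : ℝ) + 1 ≤ N := by exact_mod_cast h2
  have e : exp (-2 * x - 2 * (2 * k + 1) * t) =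
      exp ((N - k) * t - (N + k + 2) * t) *
        exp (((N + 1 - k) * t - x) - ((N + 1 + k) * t + x)) := by
    rw [← exp_add]; ring_nf
  rw [e]
  refine mul_le_mul (sinh_div_sinh_le_exp ?_ ?_) (sinh_div_sinh_le_exp ?_ ?_)
    (div_nonneg ?_ ?_) (exp_pos _).le <;> try refine sinh_nonneg_iff.2 ?_
  all_goals nlinarith

lemma le_sinhRatio {x t : ℝ} (ht : 0 < t) (hx : 0 < x) (hxt : x < t) {N : ℕ} {k : ℤ}
    (h1 : -N - 1 ≤ k) (h2 : k < 0) : exp (-2 * x - 2 * (2 * k + 1) * t) ≤ sinhRatio x t N k := by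
  have h1' : (-N - 1 : ℝ) ≤ k := by exact_mod_cast h1
  have h2' : (k : ℝ) + 1 ≤ 0 := by exact_mod_cast h2
  have e : exp (-2 * x - 2 * (2 * k + 1) * t) =
      exp ((N - k) * t - (N + k + 2) * t) *
        exp (((N + 1 - k) * t - x) - ((N + 1 + k) * t + x)) := by
    rw [← exp_add]; ring_nf
  have hN : (0 : ℝ) ≤ N := by positivity
  rw [e]
  refine mul_le_mul (exp_le_sinh_div_sinh ?_ ?_) (exp_le_sinh_div_sinh ?_ ?_)
    (exp_pos _).le (div_nonneg ?_ ?_) <;> try refine sinh_nonneg_iff.2 ?_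
  all_goals nlinarith

lemma tendsto_sinhRatio {x t : ℝ} (ht : 0 < t) (k : ℤ) :
    Tendsto (fun N : ℕ => sinhRatio x t N k) atTop
      (nhds (exp (-2 * x - 2 * (2 * k + 1) * t))) := by
  have hN : Tendsto (fun N : ℕ => (N : ℝ) * t) atTop atTop :=
    tendsto_natCast_atTop_atTop.atTop_mul_const ht
  have := ((tendsto_sinh_div_sinh (-k * t) ((k + 2) * t)).comp hN).mul
    ((tendsto_sinh_div_sinh ((1 - k) * t - x) ((1 + k) * t + x)).comp hN)
  convert this using 2 with N
  · simp only [sinhRatio, Function.comp]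
    ring_nf
  · rw [← exp_add]; ring_nf

lemma tendsto_sinhProd_div {x t : ℝ} (ht : 0 < t) (hx : 0 < x) (hxt : x < t) (k : ℤ) :
    Tendsto (fun N : ℕ => sinhProd x t N 0 / sinhProd x t N k) atTop
      (nhds (gaussWeight x t k)) := by
  have ev (k : ℤ) : ∀ᶠ N : ℕ in atTop, sinhProd x t N 0 / sinhProd x t N (k + 1) =
      sinhProd x t N 0 / sinhProd x t N k * sinhRatio x t N k := by
    filter_upwards [eventually_gt_atTop k.natAbs] with N hN
    exact sinhProd_div_succ ht hx hxt (by omega) (by omega)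
  induction k using Int.induction_on with
  | zero =>
    have h0 : gaussWeight x t 0 = 1 := by simp [gaussWeight]
    rw [h0]
    exact tendsto_const_nhds.congr fun N => (div_self (sinhProd_ne_zero ht hx hxt N 0)).symm
  | succ i ih =>
    rw [gaussWeight_succ]
    exact (ih.mul (tendsto_sinhRatio ht _)).congr' ((ev i).mono fun N h => h.symm)
  | pred i ih =>
    have hw := gaussWeight_succ x t (-i - 1)
    have hev := ev (-i - 1)
    rw [sub_add_cancel] at hw hev
    have hd := ih.div (tendsto_sinhRatio (x := x) ht (-i - 1)) (exp_pos _).ne'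
    rw [hw, mul_div_cancel_right₀ _ (exp_pos _).ne'] at hd
    refine hd.congr' ?_
    filter_upwards [hev, eventually_gt_atTop (i + 2)] with N h hN
    rw [Pi.div_apply, h,
      mul_div_cancel_right₀ _ (sinhRatio_pos ht hx hxt (by omega) (by omega)).ne']

lemma sinhProd_div_bounds {x t : ℝ} (ht : 0 < t) (hx : 0 < x) (hxt : x < t) {N : ℕ} (k : ℤ)
    (h1 : -N - 1 ≤ k) (h2 : k ≤ N) :
    0 ≤ sinhProd x t N 0 / sinhProd x t N k ∧
      sinhProd x t N 0 / sinhProd x t N k ≤ gaussWeight x t k := by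
  induction k using Int.induction_on with
  | zero => simp [gaussWeight, div_self (sinhProd_ne_zero ht hx hxt N 0)]
  | succ i ih =>
    obtain ⟨ih1, ih2⟩ := ih (by omega) (by omega)
    have hρ := (sinhRatio_pos ht hx hxt (N := N) (k := i) (by omega) (by omega)).le
    rw [sinhProd_div_succ ht hx hxt (by omega) (by omega), gaussWeight_succ]
    exact ⟨mul_nonneg ih1 hρ, mul_le_mul ih2 (sinhRatio_le ht hx hxt (by omega) (by omega)) hρ
      (exp_pos _).le⟩
  | pred i ih =>
    obtain ⟨ih1, ih2⟩ := ih (by omega) (by omega)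
    have hρ := sinhRatio_pos ht hx hxt (N := N) (k := -i - 1) (by omega) (by omega)
    have hle := le_sinhRatio ht hx hxt (N := N) (k := -i - 1) (by omega) (by omega)
    have hw := gaussWeight_succ x t (-i - 1)
    have hr := sinhProd_div_succ ht hx hxt (N := N) (k := -i - 1) (by omega) (by omega)
    rw [sub_add_cancel] at hw hr
    rw [hr] at ih1 ih2
    rw [hw] at ih2
    have hr0 := nonneg_of_mul_nonneg_left ih1 hρ
    refine ⟨hr0, le_of_mul_le_mul_right ((mul_le_mul_of_nonneg_left hle hr0).trans ih2)
      (exp_pos _)⟩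

lemma sum_inv_prod_sub_pos {ι : Type*} [DecidableEq ι] {s : Finset ι} (hs : s.Nonempty)
    {c : ι → ℝ} (hc : Set.InjOn c s) {X : ℝ} (hX : ∀ i ∈ s, 0 < X + c i) :
    0 < ∑ i ∈ s, (∏ j ∈ s.erase i, (c j - c i))⁻¹ * (X + c i)⁻¹ := by
  have hv : Set.InjOn (fun i => -c i) s := fun i hi j hj h => hc hi hj (neg_injective h)
  have hne : ∀ i ∈ s, X ≠ -c i := fun i hi h => (hX i hi).ne' (by linarith)
  have h := Lagrange.eval_interpolate_not_at_node (s := s) (v := fun i => -c i) 1 hne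
  rw [Lagrange.interpolate_one hv hs, Polynomial.eval_one, Lagrange.eval_nodal] at h
  have hP : 0 < ∏ i ∈ s, (X - -c i) := Finset.prod_pos fun i hi => by linarith [hX i hi]
  have h' := pos_of_mul_pos_right (h ▸ one_pos : (0 : ℝ) < _ * _) hP.le
  refine h'.trans_eq (Finset.sum_congr rfl fun i _ => ?_)
  rw [Lagrange.nodalWeight, Finset.prod_inv_distrib]
  simp only [Pi.one_apply, mul_one, sub_neg_eq_add]
  congr 2
  exact Finset.prod_congr rfl fun j _ => by ring

lemma cosh_sub_cosh (x t : ℝ) (j k : ℤ) :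
    cosh (x + 2 * j * t) - cosh (x + 2 * k * t) =
      2 * (sinh (x + (j + k : ℤ) * t) * sinh ((j - k : ℤ) * t)) := by
  have e1 : x + 2 * j * t = (x + (j + k : ℤ) * t) + (j - k : ℤ) * t := by push_cast; ring
  have e2 : x + 2 * k * t = (x + (j + k : ℤ) * t) - (j - k : ℤ) * t := by push_cast; ring
  rw [e1, e2, cosh_add, cosh_sub]
  ring

lemma prod_cosh_sub_cosh (x t : ℝ) {N : ℕ} {k : ℤ}
    (hk : k ∈ Finset.Ico (-N - 1 : ℤ) (N + 1)) :
    (∏ j ∈ (Finset.Ico (-N - 1 : ℤ) (N + 1)).erase k,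
        (cosh (x + 2 * j * t) - cosh (x + 2 * k * t))) * sinh (x + 2 * k * t) =
      2 ^ (2 * N + 1) * sinhProd x t N k := by
  rw [sinhProd, ← Finset.mul_prod_erase _ _ hk]
  have h0 : sinh (x + (k + k : ℤ) * t) * sinhMulOrOne t (k - k) = sinh (x + 2 * k * t) := by
    simp only [sinhMulOrOne, sub_self, if_true, mul_one]
    push_cast; ring_nf
  have hc : ((Finset.Ico (-N - 1 : ℤ) (N + 1)).erase k).card = 2 * N + 1 := by
    rw [Finset.card_erase_of_mem hk, Int.card_Ico]; omega
  rw [h0, Finset.prod_congr rfl (g := fun j =>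
    2 * (sinh (x + (j + k : ℤ) * t) * sinhMulOrOne t (j - k))) ?_, Finset.prod_mul_distrib,
    Finset.prod_const, hc]
  · ring
  · intro j hj
    have : j - k ≠ 0 := sub_ne_zero.2 (Finset.ne_of_mem_erase hj)
    rw [cosh_sub_cosh, sinhMulOrOne, if_neg this]

lemma sum_sinhProd_pos {x t : ℝ} (ht : 0 < t) (hx : 0 < x) (hxt : x < t) (u : ℝ) (N : ℕ) :
    0 < ∑ k ∈ Finset.Ico (-N - 1 : ℤ) (N + 1), sinhProd x t N 0 / sinhProd x t N k *
      (sinh (x + 2 * k * t) / (cosh u + cosh (x + 2 * k * t))) := by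
  have hinj : Set.InjOn (fun k : ℤ => cosh (x + 2 * k * t))
      (Finset.Ico (-N - 1 : ℤ) (N + 1)) := by
    intro j _ k _ h
    by_contra hjk
    have h' := cosh_sub_cosh x t j k
    simp only at h
    rw [h, sub_self] at h'
    have h1 := sinh_add_int_mul_ne_zero ht hx hxt (j + k)
    have h2 := sinhMulOrOne_ne_zero ht (j - k)
    rw [sinhMulOrOne, if_neg (sub_ne_zero.2 hjk)] at h2
    simp_all
  have hpos := sum_inv_prod_sub_pos (s := Finset.Ico (-N - 1 : ℤ) (N + 1))
    ⟨0, Finset.mem_Ico.2 (by omega)⟩ hinj (X := cosh u) fun k _ => by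
      have := cosh_pos u; have := cosh_pos (x + 2 * k * t); positivity
  have h := mul_pos (mul_pos (sinhProd_zero_pos ht hx hxt N)
    (show (0 : ℝ) < 2 ^ (2 * N + 1) by positivity)) hpos
  rw [Finset.mul_sum] at h
  refine h.trans_eq (Finset.sum_congr rfl fun k hk => ?_)
  have hp := prod_cosh_sub_cosh x t hk
  have hV := sinhProd_ne_zero ht hx hxt N k
  have hne : ∏ j ∈ (Finset.Ico (-N - 1 : ℤ) (N + 1)).erase k,
      (cosh (x + 2 * j * t) - cosh (x + 2 * k * t)) ≠ 0 := by
    intro h0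
    rw [h0, zero_mul] at hp
    exact (mul_ne_zero (by positivity) hV) hp.symm
  have hc : cosh u + cosh (x + 2 * k * t) ≠ 0 := by
    have := cosh_pos u; have := cosh_pos (x + 2 * k * t); positivity
  generalize ∏ j ∈ (Finset.Ico (-N - 1 : ℤ) (N + 1)).erase k,
    (cosh (x + 2 * j * t) - cosh (x + 2 * k * t)) = P at hp hne ⊢
  generalize sinh (x + 2 * k * t) = S at hp ⊢
  generalize cosh u + cosh (x + 2 * k * t) = C at hc ⊢
  field_simp
  linear_combination (-(sinhProd x t N 0)) * hp

lemma summable_pow_mul_gaussWeight (x : ℝ) {t : ℝ} (hx : 0 ≤ x) (ht : 0 < t) (n : ℕ) :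
    Summable fun k : ℤ => (|k| ^ n : ℝ) * gaussWeight x t k := by
  refine (summable_pow_mul_jacobiTheta₂_term_bound (x / π) (T := 2 * t / π) (by positivity)
    n).of_nonneg_of_le (fun k => by unfold gaussWeight; positivity) fun k => ?_
  unfold gaussWeight
  refine mul_le_mul_of_nonneg_left (exp_le_exp.2 ?_) (by positivity)
  have : -π * (2 * t / π * k ^ 2 - 2 * (x / π) * |(k : ℤ)|) = -2 * (-|(k : ℝ)| * x + k ^ 2 * t) := by
    push_cast
    field_simp
    ring
  rw [this]
  nlinarith [neg_abs_le (k : ℝ)]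

lemma abs_sinh_div_le_one (y u : ℝ) : |sinh y / (cosh u + cosh y)| ≤ 1 := by
  have h1 := cosh_pos u
  have h2 := cosh_pos y
  rw [abs_div, abs_of_pos (add_pos h1 h2), div_le_one (by positivity), abs_sinh]
  rw [← cosh_abs y]
  linarith [sinh_lt_cosh |y|]

lemma tsum_sinh_div_nonneg {x t : ℝ} (ht : 0 < t) (hx : 0 < x) (hxt : x < t) (u : ℝ) :
    0 ≤ ∑' k : ℤ, gaussWeight x t k *
      (sinh (x + 2 * k * t) / (cosh u + cosh (x + 2 * k * t))) := by
  have hs : Summable (gaussWeight x t) := by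
    simpa using summable_pow_mul_gaussWeight x hx.le ht 0
  set f : ℕ → ℤ → ℝ := fun N => Set.indicator (Finset.Ico (-N - 1 : ℤ) (N + 1) : Set ℤ)
    fun k => sinhProd x t N 0 / sinhProd x t N k *
      (sinh (x + 2 * k * t) / (cosh u + cosh (x + 2 * k * t))) with hf
  refine ge_of_tendsto' (tendsto_tsum_of_dominated_convergence (𝓕 := atTop) (f := f) hs (fun k => ?_)
    (Eventually.of_forall fun N k => ?_)) fun N => ?_
  · refine ((tendsto_sinhProd_div ht hx hxt k).mul_const _).congr' ?_
    filter_upwards [eventually_gt_atTop k.natAbs] with N hN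
    rw [hf]
    simp only
    rw [Set.indicator_of_mem]
    simp only [Finset.coe_Ico, Set.mem_Ico]
    omega
  · rw [hf]
    simp only
    by_cases hk : k ∈ (Finset.Ico (-N - 1 : ℤ) (N + 1) : Set ℤ)
    · rw [Set.indicator_of_mem hk]
      simp only [Finset.coe_Ico, Set.mem_Ico] at hk
      obtain ⟨h1, h2⟩ := sinhProd_div_bounds ht hx hxt (N := N) k (by omega) (by omega)
      rw [norm_mul, norm_of_nonneg h1]
      calc _ ≤ gaussWeight x t k * 1 :=
            mul_le_mul h2 (abs_sinh_div_le_one _ _) (abs_nonneg _) (exp_pos _).le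
        _ = _ := mul_one _
    · rw [Set.indicator_of_notMem hk, norm_zero]
      exact (exp_pos _).le
  · rw [hf]
    simp only
    rw [← sum_eq_tsum_indicator]
    exact (sum_sinhProd_pos ht hx hxt u N).le

lemma sigmoid_mul_one_sub_eq (u : ℝ) :
    sigmoid u * (1 - sigmoid u) = (2 * (1 + cosh u))⁻¹ := by
  rw [← sigmoid_neg, sigmoid_def, sigmoid_def, neg_neg, cosh_eq, ← mul_inv]
  congr 1
  have : exp (-u) * exp u = 1 := by rw [← exp_add]; simp
  linear_combination this

lemma integrable_sigmoid_mul_one_sub :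
    Integrable fun u : ℝ => sigmoid u * (1 - sigmoid u) := by
  have h := (integrableOn_image_iff_integrableOn_abs_deriv_smul MeasurableSet.univ
    (fun u _ => (hasDerivAt_sigmoid u).hasDerivWithinAt) sigmoid_injective.injOn
    (fun _ => (1 : ℝ))).1 (by
      rw [Set.image_univ, range_sigmoid]
      exact integrableOn_const (by simp))
  rw [integrableOn_univ] at h
  refine h.congr (Eventually.of_forall fun u => ?_)
  have : 0 ≤ sigmoid u * (1 - sigmoid u) :=
    mul_nonneg (sigmoid_nonneg u) (sub_nonneg.2 (sigmoid_le_one u))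
  simp [abs_of_nonneg this]

lemma integral_cexp_mul_sigmoid (a : ℝ) (ha : a ≠ 0) :
    ∫ u : ℝ, Complex.exp (Complex.I * a * u) * ((sigmoid u * (1 - sigmoid u) : ℝ) : ℂ) =
      π * a / sinh (a * π) := by
  have himg := integral_image_eq_integral_abs_deriv_smul MeasurableSet.univ
    (fun u _ => (hasDerivAt_sigmoid u).hasDerivWithinAt) sigmoid_injective.injOn
    (fun p : ℝ => (p : ℂ) ^ (1 + Complex.I * a - 1) * (1 - (p : ℂ)) ^ (1 - Complex.I * a - 1))
  rw [Set.image_univ, range_sigmoid, setIntegral_univ] at himg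
  have hbeta := Complex.Gamma_mul_Gamma_eq_betaIntegral (s := 1 + Complex.I * a)
    (t := 1 - Complex.I * a) (by simp) (by simp)
  rw [Complex.betaIntegral, intervalIntegral.integral_of_le zero_le_one,
    integral_Ioc_eq_integral_Ioo, himg, show 1 + Complex.I * a + (1 - Complex.I * a) = 1 + 1 by ring,
    Complex.Gamma_add_one _ one_ne_zero, Complex.Gamma_one, one_mul, one_mul, add_comm 1,
    Complex.Gamma_add_one _ (by simp [ha]), mul_assoc, Complex.Gamma_mul_Gamma_one_sub,
    show (π : ℂ) * (Complex.I * a) = (a * π : ℂ) * Complex.I by ring, Complex.sin_mul_I] at hbeta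
  have hs : Complex.sinh (a * π) ≠ 0 := by
    have : sinh (a * π) ≠ 0 := by simp [sinh_eq_zero, ha, pi_ne_zero]
    exact_mod_cast this
  have hL : Complex.I * a * (π / (Complex.sinh (a * π) * Complex.I)) = π * a / sinh (a * π) := by
    push_cast
    field_simp
  rw [hL] at hbeta
  rw [hbeta]
  refine integral_congr_ae (Eventually.of_forall fun u => ?_)
  have h1 : 0 < sigmoid u := sigmoid_pos u
  have h2 : 0 < sigmoid (-u) := sigmoid_pos _
  have hlog : log (sigmoid u) - log (sigmoid (-u)) = u := by
    rw [← sigmoid_mul_rexp_neg u, log_mul h1.ne' (exp_pos _).ne', log_exp]; ring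
  have hpow : (sigmoid u : ℂ) ^ (1 + Complex.I * a - 1) *
      (1 - (sigmoid u : ℂ)) ^ (1 - Complex.I * a - 1) = Complex.exp (Complex.I * a * u) := by
    rw [show (1 : ℂ) - (sigmoid u : ℂ) = (sigmoid (-u) : ℂ) by rw [sigmoid_neg]; push_cast; rfl,
      Complex.cpow_def_of_ne_zero (by exact_mod_cast h1.ne'),
      Complex.cpow_def_of_ne_zero (by exact_mod_cast h2.ne'), ← Complex.exp_add,
      ← Complex.ofReal_log h1.le, ← Complex.ofReal_log h2.le]
    congr 1
    have : (log (sigmoid u) : ℂ) - log (sigmoid (-u)) = u := by exact_mod_cast hlog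
    linear_combination Complex.I * a * this
  have hpos : 0 ≤ sigmoid u * (1 - sigmoid u) :=
    mul_nonneg (sigmoid_nonneg u) (sub_nonneg.2 (sigmoid_le_one u))
  simp only
  rw [add_comm (Complex.I * a) 1, hpow, abs_of_nonneg hpos, Complex.real_smul, mul_comm]

lemma sinh_div_eq_sigmoid_sub (y u : ℝ) :
    sinh y / (cosh u + cosh y) = sigmoid (u + y) - sigmoid (u - y) := by
  rw [sigmoid_def, sigmoid_def, sinh_eq, cosh_eq, cosh_eq, neg_add, neg_sub, sub_eq_add_neg y u,
    exp_add, exp_add, exp_neg u, exp_neg y]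
  have := exp_pos u
  have := exp_pos y
  field_simp
  ring

lemma integrable_sinh_div (y : ℝ) : Integrable fun u : ℝ => sinh y / (cosh u + cosh y) := by
  refine (integrable_sigmoid_mul_one_sub.const_mul (2 * |sinh y|)).mono' ?_
    (Eventually.of_forall fun u => ?_)
  · refine Continuous.aestronglyMeasurable (continuous_const.div (by fun_prop) fun u => ?_)
    have := cosh_pos u; have := cosh_pos y; positivity
  · have h1 := cosh_pos u
    have h2 := one_le_cosh y
    rw [sigmoid_mul_one_sub_eq, norm_div, norm_eq_abs, norm_eq_abs,
      abs_of_pos (by positivity : 0 < cosh u + cosh y), mul_inv]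
    rw [show 2 * |sinh y| * (2⁻¹ * (1 + cosh u)⁻¹) = |sinh y| / (1 + cosh u) by
      rw [div_eq_mul_inv]; ring]
    exact div_le_div_of_nonneg_left (abs_nonneg _) (by positivity) (by linarith)

lemma integrable_cexp_mul {f : ℝ → ℝ} (hf : Integrable f) (a : ℝ) :
    Integrable fun u : ℝ => Complex.exp (Complex.I * a * u) * (f u : ℂ) := by
  refine hf.norm.mono' (AEStronglyMeasurable.mul (Continuous.aestronglyMeasurable (by fun_prop))
    hf.ofReal.aestronglyMeasurable) (Eventually.of_forall fun u => ?_)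
  rw [norm_mul, mul_assoc, ← Complex.ofReal_mul, Complex.norm_exp_I_mul_ofReal, one_mul,
    Complex.norm_real]

lemma integral_cexp_mul_comp_add (f : ℝ → ℝ) (a y : ℝ) :
    ∫ u : ℝ, Complex.exp (Complex.I * a * u) * (f (u + y) : ℂ) =
      Complex.exp (-(Complex.I * a * y)) *
        ∫ u : ℝ, Complex.exp (Complex.I * a * u) * (f u : ℂ) := by
  rw [← integral_const_mul, ← integral_add_right_eq_self
    (fun u : ℝ => Complex.exp (-(Complex.I * a * y)) * (Complex.exp (Complex.I * a * u) * f u)) y]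
  refine integral_congr_ae (Eventually.of_forall fun u => ?_)
  simp only
  rw [← mul_assoc, ← Complex.exp_add]
  push_cast
  ring_nf

lemma integral_cexp_mul_sinh_div (a : ℝ) (ha : a ≠ 0) (y : ℝ) :
    ∫ u : ℝ, Complex.exp (Complex.I * a * u) * ((sinh y / (cosh u + cosh y) : ℝ) : ℂ) =
      ((2 * π / sinh (a * π) * sin (a * y) : ℝ) : ℂ) := by
  have haC : (a : ℂ) ≠ 0 := by exact_mod_cast ha
  set g : ℝ → ℝ := fun u => sigmoid u * (1 - sigmoid u) with hg
  have hgi : Integrable g := integrable_sigmoid_mul_one_sub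
  have hE (u : ℝ) : HasDerivAt (fun u : ℝ => Complex.exp (Complex.I * a * u) / (Complex.I * a))
      (Complex.exp (Complex.I * a * u)) u := by
    have h1 : HasDerivAt (fun u : ℝ => Complex.I * a * (u : ℂ)) (Complex.I * a) u := by
      simpa using (Complex.ofRealCLM.hasDerivAt (x := u)).const_mul (Complex.I * a)
    have h2 := h1.cexp.div_const (Complex.I * a)
    rwa [mul_div_cancel_right₀ _ (mul_ne_zero Complex.I_ne_zero haC)] at h2
  have hF (u : ℝ) : HasDerivAt (fun u : ℝ => ((sinh y / (cosh u + cosh y) : ℝ) : ℂ))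
      ((g (u + y) - g (u - y) : ℝ) : ℂ) u := by
    refine HasDerivAt.ofReal_comp ?_
    simp only [sinh_div_eq_sigmoid_sub]
    exact ((hasDerivAt_sigmoid _).comp_add_const u y).sub ((hasDerivAt_sigmoid _).comp_sub_const u y)
  have hi1 := integrable_cexp_mul (hgi.comp_add_right y) a
  have hi2 := integrable_cexp_mul (hgi.comp_sub_right y) a
  have hparts := integral_mul_deriv_eq_deriv_mul_of_integrable (fun u _ => hE u) (fun u _ => hF u)
    (by
      refine ((hi1.sub hi2).div_const (Complex.I * a)).congr (Eventually.of_forall fun u => ?_)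
      simp only [Pi.sub_apply, Pi.mul_apply]
      push_cast; ring)
    (integrable_cexp_mul (integrable_sinh_div y) a)
    (by
      refine ((integrable_cexp_mul (integrable_sinh_div y) a).div_const (Complex.I * a)).congr
        (Eventually.of_forall fun u => ?_)
      simp only [Pi.mul_apply]
      ring)
  have hI : ∫ u : ℝ, Complex.exp (Complex.I * a * u) / (Complex.I * a) *
      ((g (u + y) - g (u - y) : ℝ) : ℂ) =
      (Complex.exp (-(Complex.I * a * y)) - Complex.exp (Complex.I * a * y)) *
        (π * a / sinh (a * π)) / (Complex.I * a) := by
    have h1 := integral_cexp_mul_comp_add g a y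
    have h2 := integral_cexp_mul_comp_add g a (-y)
    rw [integral_cexp_mul_sigmoid a ha] at h1 h2
    rw [sub_mul, ← h1]
    rw [show Complex.exp (Complex.I * a * y) = Complex.exp (-(Complex.I * a * (-y : ℝ))) by
      push_cast; ring_nf, ← h2]
    simp only [← sub_eq_add_neg]
    rw [← integral_sub hi1 hi2, ← integral_div]
    refine integral_congr_ae (Eventually.of_forall fun u => ?_)
    simp only
    push_cast; ring
  rw [hI] at hparts
  rw [← neg_eq_iff_eq_neg.2 hparts]
  have hs : Complex.sinh (a * π) ≠ 0 := by
    have : sinh (a * π) ≠ 0 := by simp [sinh_eq_zero, ha, pi_ne_zero]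
    exact_mod_cast this
  push_cast
  rw [Complex.sin, show -((a : ℂ) * y) * Complex.I = -(Complex.I * a * y) by ring,
    show ((a : ℂ) * y) * Complex.I = Complex.I * a * y by ring]
  have hI2 : (Complex.I)⁻¹ = -Complex.I := Complex.inv_I
  field_simp
  rw [Complex.I_sq]
  ring

lemma integral_sinh_div (y : ℝ) : ∫ u : ℝ, sinh y / (cosh u + cosh y) = 2 * y := by
  have hd (u : ℝ) : HasDerivAt (fun u => log (1 + exp (u + y)) - log (1 + exp (u - y)))
      (sinh y / (cosh u + cosh y)) u := by
    have h (c : ℝ) : HasDerivAt (fun u => log (1 + exp (u + c))) (sigmoid (u + c)) u := by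
      have := (((hasDerivAt_id u).add_const c).exp.const_add 1).log (by positivity)
      convert! this using 1
      rw [sigmoid_def, exp_neg]
      simp only [id]
      field_simp
      ring
    rw [sinh_div_eq_sigmoid_sub]
    exact (h y).sub (h (-y))
  have hbot (c : ℝ) : Tendsto (fun u => log (1 + exp (u + c))) atBot (nhds 0) := by
    have := ((tendsto_exp_atBot.comp (tendsto_atBot_add_const_right _ c tendsto_id)).const_add
      1).log (by norm_num)
    simpa using this
  have htop (c : ℝ) : Tendsto (fun u => log (1 + exp (u + c)) - u) atTop (nhds c) := by
    have h := ((hbot (-c)).comp tendsto_neg_atTop_atBot).add_const c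
    rw [zero_add] at h
    refine h.congr fun u => ?_
    have : 1 + exp (u + c) = exp (u + c) * (1 + exp (-u + -c)) := by
      rw [mul_add, ← exp_add, show u + c + (-u + -c) = 0 by ring, exp_zero]; ring
    rw [this, log_mul (by positivity) (by positivity), log_exp]
    simp only [Function.comp]
    ring
  have h := integral_of_hasDerivAt_of_tendsto hd (integrable_sinh_div y)
    (by simpa [sub_eq_add_neg] using (hbot y).sub (hbot (-y)))
    (((htop y).sub (htop (-y))).congr fun u => by rw [sub_sub_sub_cancel_right, ← sub_eq_add_neg])
  rw [h]; ring

lemma integral_norm_sinh_div (y : ℝ) : ∫ u : ℝ, ‖sinh y / (cosh u + cosh y)‖ = 2 * |y| := by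
  rw [← integral_sinh_div]
  refine integral_congr_ae (Eventually.of_forall fun u => ?_)
  have := cosh_pos u
  have := cosh_pos y
  simp only [norm_eq_abs]
  rw [abs_div, abs_of_pos (by positivity : 0 < cosh u + cosh y), abs_sinh, cosh_abs]

lemma summable_gaussWeight_mul_abs {x t : ℝ} (hx : 0 ≤ x) (ht : 0 < t) :
    Summable fun k : ℤ => gaussWeight x t k * (2 * |x + 2 * k * t|) := by
  have h0 := (summable_pow_mul_gaussWeight x hx ht 0).mul_left (2 * x)
  have h1 := (summable_pow_mul_gaussWeight x hx ht 1).mul_left (4 * t)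
  refine (h0.add h1).of_nonneg_of_le (fun k => mul_nonneg (exp_pos _).le (by positivity))
    fun k => ?_
  have h : |x + 2 * k * t| ≤ x + 2 * |(k : ℝ)| * t := by
    refine (abs_add_le _ _).trans_eq ?_
    rw [abs_of_nonneg hx, abs_mul, abs_mul, abs_of_pos ht, abs_two]
  have hw : 0 ≤ gaussWeight x t k := (exp_pos _).le
  push_cast
  nlinarith [mul_le_mul_of_nonneg_left h hw]

lemma hasSum_gaussWeight_mul_integral {x t : ℝ} (hx : 0 ≤ x) (ht : 0 < t) :
    HasSum (fun k : ℤ => gaussWeight x t k * (2 * (x + 2 * k * t)))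
      (∫ u : ℝ, ∑' k : ℤ, gaussWeight x t k *
        (sinh (x + 2 * k * t) / (cosh u + cosh (x + 2 * k * t)))) := by
  have h := hasSum_integral_of_summable_integral_norm (μ := volume)
    (F := fun (k : ℤ) (u : ℝ) => gaussWeight x t k *
      (sinh (x + 2 * k * t) / (cosh u + cosh (x + 2 * k * t))))
    (fun k => (integrable_sinh_div _).const_mul _) (by
      refine (summable_gaussWeight_mul_abs hx ht).congr fun k => ?_
      simp only [norm_mul]
      rw [integral_const_mul, integral_norm_sinh_div,
        norm_of_nonneg (show 0 ≤ gaussWeight x t k from (exp_pos _).le)])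
  simpa only [integral_const_mul, integral_sinh_div] using h

lemma hasSum_gaussWeight_mul_integral_cexp {x t : ℝ} (hx : 0 ≤ x) (ht : 0 < t) {a : ℝ}
    (ha : a ≠ 0) :
    HasSum (fun k : ℤ => ((gaussWeight x t k *
        (2 * π / sinh (a * π) * sin (a * (x + 2 * k * t))) : ℝ) : ℂ))
      (∫ u : ℝ, Complex.exp (Complex.I * a * u) * ((∑' k : ℤ, gaussWeight x t k *
        (sinh (x + 2 * k * t) / (cosh u + cosh (x + 2 * k * t))) : ℝ) : ℂ)) := by
  have h := hasSum_integral_of_summable_integral_norm (μ := volume)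
    (F := fun (k : ℤ) (u : ℝ) => (gaussWeight x t k : ℂ) * (Complex.exp (Complex.I * a * u) *
      ((sinh (x + 2 * k * t) / (cosh u + cosh (x + 2 * k * t)) : ℝ) : ℂ)))
    (fun k => (integrable_cexp_mul (integrable_sinh_div _) a).const_mul _) (by
      refine (summable_gaussWeight_mul_abs hx ht).congr fun k => ?_
      simp only [norm_mul, Complex.norm_real, mul_assoc Complex.I, ← Complex.ofReal_mul a,
        Complex.norm_exp_I_mul_ofReal, one_mul]
      rw [integral_const_mul, integral_norm_sinh_div,
        norm_of_nonneg (show 0 ≤ gaussWeight x t k from (exp_pos _).le)])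
  simp only [integral_const_mul, integral_cexp_mul_sinh_div a ha, ← Complex.ofReal_mul] at h
  have e (u : ℝ) : Complex.exp (Complex.I * a * u) * ((∑' k : ℤ, gaussWeight x t k *
        (sinh (x + 2 * k * t) / (cosh u + cosh (x + 2 * k * t))) : ℝ) : ℂ) =
      ∑' k : ℤ, (gaussWeight x t k : ℂ) * (Complex.exp (Complex.I * a * u) *
        ((sinh (x + 2 * k * t) / (cosh u + cosh (x + 2 * k * t)) : ℝ) : ℂ)) := by
    rw [Complex.ofReal_tsum, ← tsum_mul_left]
    refine tsum_congr fun k => ?_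
    push_cast
    ring
  simpa only [e] using h

/-- For every `a ≠ 0`, `t > 0` and `0 < x < t`, `|φ_a(x,t)| ≤ |φ_0(x,t)|`; in particular
`x ↦ φ_a(x,t)/φ_0(x,t)` is bounded by `1` in absolute value on `(0,t)`. -/
theorem abs_phi_le_abs_phi0 (a : ℝ) (ha : a ≠ 0) (t : ℝ) (ht : 0 < t)
    (x : ℝ) (hx : 0 < x) (hxt : x < t) :
    |phi a x t| ≤ |phi0 x t| := by
  have h0 := (hasSum_gaussWeight_mul_integral hx.le ht).tsum_eq
  have h1 := (hasSum_gaussWeight_mul_integral_cexp hx.le ht ha).tsum_eq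
  have e0 : 2 * phi0 x t = ∑' k : ℤ, gaussWeight x t k * (2 * (x + 2 * k * t)) := by
    rw [phi0, ← tsum_mul_left]
    refine tsum_congr fun k => ?_
    rw [gaussWeight]
    ring
  have e1 : 2 * phi a x t = ∑' k : ℤ, gaussWeight x t k *
      (2 * π / sinh (a * π) * sin (a * (x + 2 * k * t))) := by
    rw [phi, ← mul_assoc, ← tsum_mul_left]
    refine tsum_congr fun k => ?_
    rw [gaussWeight, show a * x + 2 * (k : ℝ) * a * t = a * (x + 2 * k * t) by ring]
    ring
  rw [← Complex.ofReal_tsum, ← e1] at h1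
  rw [← e0] at h0
  have h : |2 * phi a x t| ≤ 2 * phi0 x t := by
    rw [← norm_eq_abs, ← Complex.norm_real, h1, h0]
    refine (norm_integral_le_integral_norm _).trans_eq
      (integral_congr_ae (Eventually.of_forall fun u => ?_))
    simp only [norm_mul, mul_assoc Complex.I, ← Complex.ofReal_mul a,
      Complex.norm_exp_I_mul_ofReal, one_mul, Complex.norm_real]
    exact norm_of_nonneg (tsum_sinh_div_nonneg ht hx hxt u)
  rw [abs_mul, abs_two] at h
  exact le_trans (by linarith) (le_abs_self _)
end

section
/- For every t > 0 and every x with 0 < x < t, one has φ_0(x,t) ≠ 0. -/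
open Real Filter

/-- A series whose tail is bounded below by that of a small geometric series is bounded below. -/
lemma HasSum.sub_lt_of_geometric_tail {h : ℕ → ℝ} {S C q : ℝ} (hS : HasSum h S) (hC : 0 < C)
    (hq : 0 ≤ q) (hq' : q < 1 / 2) (hh : ∀ m : ℕ, -(C * q ^ (m + 1)) ≤ h (m + 1)) :
    h 0 - C < S := by
  have h1 : HasSum (fun m => h (m + 1)) (S - h 0) := by
    simpa using (hasSum_nat_add_iff' (f := h) 1).mpr hS
  have h2 := ((hasSum_geometric_of_lt_one hq (by linarith)).mul_left (C * q)).neg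
  have h3 := hasSum_le (fun m => by
    refine le_trans (le_of_eq ?_) (hh m)
    ring) h2 h1
  have h4 : q * (1 - q)⁻¹ < 1 := by
    rw [← div_eq_mul_inv, div_lt_one (by linarith)]
    linarith
  nlinarith [mul_lt_mul_of_pos_left h4 hC]

lemma abs_sin_nat_mul_le (n : ℕ) (θ : ℝ) : |sin (n * θ)| ≤ n * |sin θ| := by
  induction n with
  | zero => simp
  | succ n ih =>
    push_cast
    rw [add_mul, one_mul, sin_add]
    calc |sin (n * θ) * cos θ + cos (n * θ) * sin θ|
        ≤ |sin (n * θ)| * |cos θ| + |cos (n * θ)| * |sin θ| := by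
          simpa only [abs_mul] using abs_add_le (sin (n * θ) * cos θ) (cos (n * θ) * sin θ)
      _ ≤ |sin (n * θ)| * 1 + 1 * |sin θ| := by
          gcongr
          · exact abs_cos_le_one _
          · exact abs_cos_le_one _
      _ ≤ (n + 1) * |sin θ| := by linarith

lemma succ_sq_le_four_pow (m : ℕ) : ((m : ℝ) + 1) ^ 2 ≤ 4 ^ m := by
  induction m with
  | zero => simp
  | succ m ih =>
    have : (0 : ℝ) ≤ m := m.cast_nonneg
    push_cast
    rw [pow_succ (4 : ℝ)]
    nlinarith

/-- Past its maximum, `v ↦ v * exp (-c * v ^ 2)` is decreasing. -/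
lemma mul_exp_neg_sq_lt {c p q : ℝ} (hp : 0 < p) (hpq : p < q) (hc : 1 < c * p * (p + q)) :
    q * exp (-(c * q ^ 2)) < p * exp (-(c * p ^ 2)) := by
  have h1 : exp (-(c * p ^ 2)) = exp (-(c * q ^ 2)) * exp (c * (q ^ 2 - p ^ 2)) := by
    rw [← exp_add]
    ring_nf
  have h2 := add_one_le_exp (c * (q ^ 2 - p ^ 2))
  have h3 : q < p * exp (c * (q ^ 2 - p ^ 2)) := by
    nlinarith [mul_le_mul_of_nonneg_left h2 hp.le, mul_lt_mul_of_pos_left hc (sub_pos.2 hpq)]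
  rw [h1]
  nlinarith [exp_pos (-(c * q ^ 2))]

lemma sinKernel_pos {a T : ℝ} (ha : 0 < a) (ha' : a < 1 / 2) (hT : 1 / 4 ≤ T) :
    0 < HurwitzZeta.sinKernel a T := by
  have hT0 : 0 < T := by linarith
  have hsin : 0 < sin (2 * π * a) :=
    sin_pos_of_pos_of_lt_pi (by positivity) (by nlinarith [pi_pos])
  have hsum := HurwitzZeta.hasSum_nat_sinKernel a hT0
  have hsum1 := (hasSum_nat_add_iff' 1).mpr hsum
  simp only [Finset.range_one, Finset.sum_singleton, Nat.cast_zero, mul_zero, zero_mul,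
    sub_zero] at hsum1
  have hpi : 3 / 4 ≤ π * T := by nlinarith [pi_gt_three]
  have hr : exp (-(9 / 4 : ℝ)) * 4 ≤ 9 / 20 := by
    have h2 : (80 / 9 : ℝ) ≤ exp (9 / 4) := by
      have : exp (9 / 4 : ℝ) = exp 1 * exp 1 * exp (1 / 4) := by
        rw [← exp_add, ← exp_add]; norm_num
      rw [this]
      nlinarith [exp_one_gt_d9, add_one_le_exp (1 / 4 : ℝ), exp_pos (1 / 4 : ℝ),
        mul_self_nonneg (exp 1 - 2.7)]
    rw [exp_neg, inv_mul_le_iff₀ (exp_pos _)]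
    linarith
  have key := hsum1.sub_lt_of_geometric_tail
    (C := 2 * sin (2 * π * a) * exp (-π * T)) (q := 9 / 20)
    (by positivity) (by norm_num) (by norm_num) ?_
  · convert key using 1
    norm_num
  · intro m
    obtain ⟨k, hk⟩ : ∃ k : ℕ, k = m + 1 := ⟨_, rfl⟩
    rw [← hk]
    have hk1 : (1 : ℝ) ≤ k := by rw [hk]; push_cast; linarith [m.cast_nonneg (α := ℝ)]
    have hs : -((k + 1) * sin (2 * π * a)) ≤ sin (2 * π * a * (k + 1)) := by
      have := (abs_le.mp (abs_sin_nat_mul_le (k + 1) (2 * π * a))).1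
      rw [abs_of_pos hsin] at this
      push_cast at this
      rwa [mul_comm (2 * π * a)]
    have he : exp (-π * (k + 1) ^ 2 * T) ≤ exp (-π * T) * exp (-(9 / 4)) ^ k := by
      rw [← exp_nat_mul, ← exp_add, exp_le_exp]
      nlinarith [mul_le_mul_of_nonneg_right hpi (by nlinarith : (0 : ℝ) ≤ k ^ 2 + 2 * k)]
    have hpow : ((k : ℝ) + 1) ^ 2 * exp (-(9 / 4)) ^ k ≤ (9 / 20) ^ k := by
      calc ((k : ℝ) + 1) ^ 2 * exp (-(9 / 4)) ^ k ≤ 4 ^ k * exp (-(9 / 4)) ^ k := by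
            gcongr; exact succ_sq_le_four_pow k
        _ = (exp (-(9 / 4)) * 4) ^ k := by rw [mul_pow]; ring
        _ ≤ _ := by gcongr
    push_cast
    have hmain : 2 * (k + 1) * ((k + 1) * sin (2 * π * a)) * exp (-π * (k + 1) ^ 2 * T)
        ≤ 2 * sin (2 * π * a) * exp (-π * T) * (9 / 20) ^ k := by
      calc _ ≤ 2 * (k + 1) * ((k + 1) * sin (2 * π * a)) *
            (exp (-π * T) * exp (-(9 / 4)) ^ k) := by gcongr
        _ = 2 * sin (2 * π * a) * exp (-π * T) * ((k + 1) ^ 2 * exp (-(9 / 4)) ^ k) := by ring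
        _ ≤ _ := by gcongr
    have : 2 * (k + 1) * -((k + 1) * sin (2 * π * a)) * exp (-π * (k + 1) ^ 2 * T) ≤
        2 * (k + 1) * sin (2 * π * a * (k + 1)) * exp (-π * (k + 1) ^ 2 * T) := by gcongr
    linarith

lemma four_mul_exp_neg_half_le {c : ℝ} (hc : 12 ≤ c) : 4 * c * exp (-(c / 2)) ≤ 9 / 20 := by
  have h6 : (380 : ℝ) ≤ exp 6 := by
    have : exp (6 : ℝ) = exp 1 ^ 6 := by rw [← exp_nat_mul]; norm_num
    rw [this]
    calc (380 : ℝ) ≤ 2.7 ^ 6 := by norm_num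
      _ ≤ exp 1 ^ 6 := by gcongr; linarith [exp_one_gt_d9]
  have h : exp (c / 2) = exp 6 * exp (c / 2 - 6) := by rw [← exp_add]; ring_nf
  have h1 : 380 * (c / 2 - 5) ≤ exp (c / 2) := by
    rw [h]
    have := add_one_le_exp (c / 2 - 6)
    have : c / 2 - 5 ≤ exp (c / 2 - 6) := by linarith
    gcongr
    linarith
  rw [exp_neg, mul_inv_le_iff₀ (exp_pos _)]
  linarith

lemma hasSum_gaussian_pos_of_quarter_le {a c S : ℝ} (ha : 1 / 4 ≤ a) (ha' : a < 1 / 2)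
    (hc : 12 ≤ c)
    (hS : HasSum (fun n : ℤ => ((n : ℝ) + a) * exp (-(c * ((n : ℝ) + a) ^ 2))) S) : 0 < S := by
  have h := hS.nat_add_neg_add_one
  have hpos : ∀ n : ℕ, 0 < (((n : ℤ) : ℝ) + a) * exp (-(c * (((n : ℤ) : ℝ) + a) ^ 2)) +
      (((-((n : ℤ) + 1) : ℤ) : ℝ) + a) * exp (-(c * (((-((n : ℤ) + 1) : ℤ) : ℝ) + a) ^ 2)) := by
    intro n
    have hn : (0 : ℝ) ≤ n := n.cast_nonneg
    have := mul_exp_neg_sq_lt (c := c) (p := n + a) (q := n + 1 - a) (by linarith) (by linarith)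
      (by nlinarith [mul_nonneg hn hn, mul_nonneg hn (by linarith : 0 ≤ a)])
    push_cast
    rw [show (-((n : ℝ) + 1) + a) ^ 2 = (n + 1 - a) ^ 2 by ring]
    linarith
  rw [← h.tsum_eq]
  exact h.summable.tsum_pos (fun n => (hpos n).le) 0 (hpos 0)

lemma hasSum_gaussian_pos_of_le_quarter {a c S : ℝ} (ha : 0 < a) (ha' : a ≤ 1 / 4)
    (hc : 12 ≤ c)
    (hS : HasSum (fun n : ℤ => ((n : ℝ) + a) * exp (-(c * ((n : ℝ) + a) ^ 2))) S) : 0 < S := by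
  have key := hS.nat_add_neg.sub_lt_of_geometric_tail
    (C := a * exp (-(c * a ^ 2))) (q := 9 / 20)
    (by positivity) (by norm_num) (by norm_num) ?_
  · simp only [Nat.cast_zero, Int.cast_zero, zero_add, neg_zero] at key
    linarith
  · intro m
    obtain ⟨k, hk⟩ : ∃ k : ℝ, k = m + 1 := ⟨_, rfl⟩
    have hk1 : 1 ≤ k := by rw [hk]; linarith [m.cast_nonneg (α := ℝ)]
    push_cast
    rw [← hk]
    have e1 : exp (-(c * (k + a) ^ 2)) =
        exp (-(c * a ^ 2)) * (exp (-(c * k ^ 2)) * exp (-(2 * c * k * a))) := by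
      rw [← exp_add, ← exp_add]; ring_nf
    have e2 : exp (-(c * (-k + a) ^ 2)) =
        exp (-(c * a ^ 2)) * (exp (-(c * k ^ 2)) * exp (2 * c * k * a)) := by
      rw [← exp_add, ← exp_add]; ring_nf
    have hdiff : exp (2 * c * k * a) - exp (-(2 * c * k * a)) ≤
        4 * c * k * a * exp (2 * c * k * a) := by
      have : exp (-(2 * c * k * a)) = exp (2 * c * k * a) * exp (-(4 * c * k * a)) := by
        rw [← exp_add]; ring_nf
      rw [this]
      nlinarith [add_one_le_exp (-(4 * c * k * a)), exp_pos (2 * c * k * a)]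
    have hodd : (k - a) * exp (2 * c * k * a) - (k + a) * exp (-(2 * c * k * a)) ≤
        k * (4 * c * k * a * exp (2 * c * k * a)) := by
      have := mul_le_mul_of_nonneg_left hdiff (by linarith : 0 ≤ k)
      nlinarith [mul_pos ha (exp_pos (2 * c * k * a)), mul_pos ha (exp_pos (-(2 * c * k * a)))]
    have hexp : exp (-(c * k ^ 2)) * exp (2 * c * k * a) ≤ exp (-(c / 2)) ^ (m + 1) := by
      rw [← exp_nat_mul, ← exp_add, exp_le_exp]
      push_cast
      rw [← hk]
      have hck : 0 ≤ c * k := by nlinarith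
      nlinarith [mul_le_mul_of_nonneg_left ha' hck, mul_le_mul_of_nonneg_left hk1 hck]
    have hpoly : 4 * c * k ^ 2 ≤ (4 * c) ^ (m + 1) := by
      calc 4 * c * k ^ 2 ≤ 4 * c * (4 * c) ^ m := by
            gcongr
            rw [hk]
            exact (succ_sq_le_four_pow m).trans (by gcongr; linarith)
        _ = _ := by ring
    have hmain : exp (-(c * k ^ 2)) *
        ((k - a) * exp (2 * c * k * a) - (k + a) * exp (-(2 * c * k * a))) ≤
        a * (9 / 20) ^ (m + 1) := by
      calc _ ≤ exp (-(c * k ^ 2)) * (k * (4 * c * k * a * exp (2 * c * k * a))) := by gcongr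
        _ = a * ((4 * c * k ^ 2) * (exp (-(c * k ^ 2)) * exp (2 * c * k * a))) := by ring
        _ ≤ a * ((4 * c) ^ (m + 1) * exp (-(c / 2)) ^ (m + 1)) := by gcongr
        _ = a * (4 * c * exp (-(c / 2))) ^ (m + 1) := by rw [← mul_pow]
        _ ≤ _ := by gcongr; exact four_mul_exp_neg_half_le hc
    rw [e1, e2]
    nlinarith [mul_le_mul_of_nonneg_left hmain (exp_pos (-(c * a ^ 2))).le]

lemma oddKernel_pos {a s : ℝ} (ha : 0 < a) (ha' : a < 1 / 2) (hs : 0 < s) :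
    0 < HurwitzZeta.oddKernel a s := by
  rcases le_total s 4 with h4 | h4
  · rw [HurwitzZeta.oddKernel_functional_equation]
    exact mul_pos (by positivity)
      (sinKernel_pos ha ha' (one_div_le_one_div_of_le hs h4))
  · have hS := HurwitzZeta.hasSum_int_oddKernel a hs
    have hc : 12 ≤ π * s := by nlinarith [pi_gt_three]
    have hS' : HasSum (fun n : ℤ => ((n : ℝ) + a) * exp (-(π * s * ((n : ℝ) + a) ^ 2)))
        (HurwitzZeta.oddKernel a s) := by
      refine hS.congr_fun fun n => ?_
      ring_nf
    rcases le_total a (1 / 4) with h | h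
    · exact hasSum_gaussian_pos_of_le_quarter ha h hc hS'
    · exact hasSum_gaussian_pos_of_quarter_le h ha' hc hS'

lemma phi0_eq_oddKernel {t : ℝ} (ht : 0 < t) (x : ℝ) :
    phi0 x t = 2 * t * exp (x ^ 2 / (2 * t)) *
      HurwitzZeta.oddKernel (x / (2 * t) : ℝ) (2 * t / π) := by
  rw [phi0, ← (HurwitzZeta.hasSum_int_oddKernel _ (by positivity)).tsum_eq, ← tsum_mul_left]
  congr 1 with k
  have he : exp (-2 * ((k : ℝ) * x + (k : ℝ) ^ 2 * t)) = exp (x ^ 2 / (2 * t)) *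
      exp (-π * (k + x / (2 * t)) ^ 2 * (2 * t / π)) := by
    rw [← exp_add]
    congr 1
    field_simp
    ring
  rw [he]
  field_simp
  ring

/-- For every `t > 0` and every `x` with `0 < x < t`, `φ_0(x,t) ≠ 0`. -/
theorem phi0_ne_zero (t : ℝ) (ht : 0 < t) (x : ℝ) (hx : 0 < x) (hxt : x < t) :
    phi0 x t ≠ 0 := by
  rw [phi0_eq_oddKernel ht]
  have hlt : x / (2 * t) < 1 / 2 := by
    rw [div_lt_iff₀ (by positivity)]
    linarith
  have := oddKernel_pos (s := 2 * t / π) (by positivity : 0 < x / (2 * t)) hlt (by positivity)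
  positivity
end

section
/- Let t > 0. If μ and ν are Borel probability measures on ℝ, both supported in the open interval (0,t), such that ∫ φ_{nπ/t}(x,t)/φ_0(x,t) dμ(x) = ∫ φ_{nπ/t}(x,t)/φ_0(x,t) dν(x) for every positive integer n, then μ = ν. (Note that φ_0(x,t) ≠ 0 for 0 < x < t, so the integrands are well defined on (0,t).) -/
open Real Filter

open MeasureTheory

open Topology

/-- The finite `q`-Pochhammer product `(q²; q²)_n = ∏_{i=1}^n (1 - q^{2i})`. -/
noncomputable def sqPoch (q : ℝ) (n : ℕ) : ℝ := ∏ i ∈ Finset.range n, (1 - q ^ (2 * (i + 1)))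

/-- The reciprocal of `(q²; q²)_n`, extended by zero to negative integers `n`. -/
noncomputable def recSqPoch (q : ℝ) (n : ℤ) : ℝ := if n < 0 then 0 else (sqPoch q n.toNat)⁻¹

/-- The Laurent coefficients of the finite Jacobi triple product. -/
noncomputable def tripleCoeff (q : ℝ) (N : ℕ) (k : ℤ) : ℝ :=
  q ^ (k ^ 2) * sqPoch q (2 * N) * recSqPoch q (N - k) * recSqPoch q (N + k)

section TripleProduct

variable {q : ℝ}

lemma sqPoch_succ (q : ℝ) (n : ℕ) : sqPoch q (n + 1) = sqPoch q n * (1 - q ^ (2 * (n + 1))) :=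
  Finset.prod_range_succ _ _

lemma one_sub_pow_pos (h0 : 0 < q) (h1 : q < 1) (n : ℕ) : 0 < 1 - q ^ (2 * (n + 1)) :=
  sub_pos.2 (pow_lt_one₀ h0.le h1 (by lia))

lemma sqPoch_pos (h0 : 0 < q) (h1 : q < 1) (n : ℕ) : 0 < sqPoch q n :=
  Finset.prod_pos fun i _ => one_sub_pow_pos h0 h1 i

lemma sqPoch_antitone (h0 : 0 < q) (h1 : q < 1) : Antitone (sqPoch q) :=
  antitone_nat_of_succ_le fun n => by
    rw [sqPoch_succ]
    exact mul_le_of_le_one_right (sqPoch_pos h0 h1 n).le (sub_le_self _ (by positivity))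

lemma exists_tendsto_sqPoch (h0 : 0 < q) (h1 : q < 1) :
    ∃ L, 0 < L ∧ Tendsto (sqPoch q) atTop (𝓝 L) := by
  have hs : Summable fun i : ℕ => ‖-q ^ (2 * (i + 1))‖ := by
    have := (summable_geometric_of_lt_one (sq_nonneg q) (pow_lt_one₀ h0.le h1 two_ne_zero))
    have := (summable_nat_add_iff 1).2 this
    refine this.congr fun i => ?_
    rw [norm_neg, Real.norm_of_nonneg (by positivity), pow_mul]
  have hne := tprod_one_add_ne_zero_of_summable
    (fun i => by have := one_sub_pow_pos h0 h1 i; rw [← sub_eq_add_neg]; exact this.ne') hs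
  have ht : Tendsto (sqPoch q) atTop (𝓝 (∏' i : ℕ, (1 + -q ^ (2 * (i + 1))))) := by
    have := (multipliable_one_add_of_summable hs).hasProd.tendsto_prod_nat
    simp only [← sub_eq_add_neg] at this ⊢
    exact this
  exact ⟨_, lt_of_le_of_ne (ge_of_tendsto' ht fun n => (sqPoch_pos h0 h1 n).le) hne.symm, ht⟩

lemma recSqPoch_natCast (q : ℝ) (n : ℕ) : recSqPoch q n = (sqPoch q n)⁻¹ := by
  simp [recSqPoch]

lemma recSqPoch_sub_one (h0 : 0 < q) (h1 : q < 1) (n : ℤ) :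
    recSqPoch q (n - 1) = (1 - q ^ (2 * n)) * recSqPoch q n := by
  rcases lt_trichotomy n 0 with hn | rfl | hn
  · simp [recSqPoch, hn, show n < 1 by lia]
  · simp [recSqPoch]
  · obtain ⟨m, rfl⟩ : ∃ m : ℕ, n = (m : ℤ) + 1 := ⟨(n - 1).toNat, by lia⟩
    have h : q ^ (2 * ((m : ℤ) + 1)) = q ^ (2 * (m + 1)) := by
      rw [← zpow_natCast]; push_cast; rfl
    have h2 := recSqPoch_natCast q (m + 1)
    push_cast at h2
    rw [add_sub_cancel_right, recSqPoch_natCast, h2, sqPoch_succ, h]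
    have := (one_sub_pow_pos h0 h1 m).ne'
    have := (sqPoch_pos h0 h1 m).ne'
    field_simp

lemma recSqPoch_nonneg (h0 : 0 < q) (h1 : q < 1) (n : ℤ) : 0 ≤ recSqPoch q n := by
  unfold recSqPoch
  split_ifs
  · rfl
  · exact (inv_pos.2 (sqPoch_pos h0 h1 _)).le

lemma tripleCoeff_succ (h0 : 0 < q) (h1 : q < 1) (N : ℕ) (k : ℤ) :
    tripleCoeff q (N + 1) k = (1 + q ^ (2 * (2 * N + 1))) * tripleCoeff q N k
      + q ^ (2 * N + 1) * (tripleCoeff q N (k - 1) + tripleCoeff q N (k + 1)) := by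
  have e1 := recSqPoch_sub_one h0 h1 (N + 1 - k)
  have e2 := recSqPoch_sub_one h0 h1 (N + 1 + k)
  have e3 := recSqPoch_sub_one h0 h1 (N - k)
  have e4 := recSqPoch_sub_one h0 h1 (N + k)
  rw [show (N : ℤ) + 1 - k - 1 = N - k by ring] at e1
  rw [show (N : ℤ) + 1 + k - 1 = N + k by ring] at e2
  rw [e1] at e3
  rw [e2] at e4
  unfold tripleCoeff
  rw [show 2 * (N + 1) = 2 * N + 1 + 1 by ring, sqPoch_succ, sqPoch_succ]
  push_cast
  rw [show (N : ℤ) - (k - 1) = N + 1 - k by ring, show (N : ℤ) + (k - 1) = N + k - 1 by ring,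
    show (N : ℤ) - (k + 1) = N - k - 1 by ring, show (N : ℤ) + (k + 1) = N + 1 + k by ring,
    e3, e4, e1, e2]
  generalize recSqPoch q (N + 1 - k) = a
  generalize recSqPoch q (N + 1 + k) = b
  generalize sqPoch q (2 * N) = c
  have hq := h0.ne'
  rw [show (k - 1) ^ 2 = k ^ 2 - k - k + 1 by ring, show (k + 1) ^ 2 = k ^ 2 + k + k + 1 by ring,
    show 2 * ((N : ℤ) + 1 - k) = N + N + 1 + 1 - k - k by ring,
    show 2 * ((N : ℤ) + 1 + k) = N + N + 1 + 1 + k + k by ring,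
    show 2 * ((N : ℤ) - k) = N + N - k - k by ring,
    show 2 * ((N : ℤ) + k) = N + N + k + k by ring]
  simp only [zpow_add₀ hq, zpow_sub₀ hq, zpow_one, zpow_natCast]
  have hk : q ^ k ≠ 0 := zpow_ne_zero _ hq
  generalize q ^ k = X at *
  generalize q ^ (k ^ 2) = Y
  field_simp
  ring

lemma tripleCoeff_eq_zero {N : ℕ} {k : ℤ} (hk : k ∉ Finset.Icc (-(N : ℤ)) N) :
    tripleCoeff q N k = 0 := by
  rw [Finset.mem_Icc, not_and_or, not_le, not_le] at hk
  rcases hk with h | h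
  · simp [tripleCoeff, recSqPoch, show (N : ℤ) + k < 0 by lia]
  · simp [tripleCoeff, recSqPoch, show (N : ℤ) - k < 0 by lia]

lemma hasSum_tripleCoeff (h0 : 0 < q) (h1 : q < 1) (y : ℝ) (N : ℕ) :
    HasSum (fun k : ℤ => tripleCoeff q N k * cos (k * y))
      (∏ i ∈ Finset.range N, (1 + q ^ (2 * (2 * i + 1)) + 2 * q ^ (2 * i + 1) * cos y)) := by
  induction N with
  | zero =>
    have h : ∀ k : ℤ, k ≠ 0 → tripleCoeff q 0 k * cos (k * y) = 0 := fun k hk => by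
      rcases lt_or_gt_of_ne hk with h | h <;> simp [tripleCoeff, recSqPoch, h]
    simpa [tripleCoeff, recSqPoch, sqPoch] using hasSum_single 0 h
  | succ N ih =>
    rw [Finset.prod_range_succ]
    have hsum (f : ℤ → ℝ) : Summable fun k : ℤ => tripleCoeff q N k * f k :=
      summable_of_ne_finset_zero (s := Finset.Icc (-(N : ℤ)) N) fun k hk => by
        rw [tripleCoeff_eq_zero hk, zero_mul]
    have hp := (hsum fun k => cos ((k + 1 : ℤ) * y)).hasSum
    have hm := (hsum fun k => cos ((k - 1 : ℤ) * y)).hasSum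
    have hadd := (hp.add hm).unique <| (ih.mul_left (2 * cos y)).congr_fun fun k => by
      push_cast
      rw [add_mul, sub_mul, one_mul, cos_add, cos_sub]
      ring
    have hp' := (Equiv.subRight (1 : ℤ)).hasSum_iff.2 hp
    have hm' := (Equiv.addRight (1 : ℤ)).hasSum_iff.2 hm
    convert! (ih.mul_left (1 + q ^ (2 * (2 * N + 1)))).add
      ((hp'.add hm').mul_left (q ^ (2 * N + 1))) using 1
    · ext k
      simp only [tripleCoeff_succ h0 h1, Function.comp, Equiv.subRight_apply, Equiv.coe_addRight,
        sub_add_cancel, add_sub_cancel_right]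
      ring
    · rw [hadd]
      ring

lemma tendsto_recSqPoch {L : ℝ} (hL : 0 < L) (h : Tendsto (sqPoch q) atTop (𝓝 L)) (k : ℤ) :
    Tendsto (fun N : ℕ => recSqPoch q (N + k)) atTop (𝓝 L⁻¹) := by
  have ht : Tendsto (fun N : ℕ => ((N : ℤ) + k).toNat) atTop atTop :=
    tendsto_atTop.2 fun b => by
      filter_upwards [eventually_ge_atTop (b + k.natAbs)] with N hN
      lia
  refine ((h.comp ht).inv₀ hL.ne').congr' ?_
  filter_upwards [eventually_ge_atTop k.natAbs] with N hN
  simp [recSqPoch, show ¬ ((N : ℤ) + k < 0) by lia]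

lemma recSqPoch_le (h0 : 0 < q) (h1 : q < 1) {L : ℝ} (hL : 0 < L)
    (h : Tendsto (sqPoch q) atTop (𝓝 L)) (n : ℤ) : recSqPoch q n ≤ L⁻¹ := by
  unfold recSqPoch
  split_ifs
  · positivity
  · exact inv_anti₀ hL ((sqPoch_antitone h0 h1).le_of_tendsto h _)

lemma summable_zpow_sq (h0 : 0 < q) (h1 : q < 1) : Summable fun k : ℤ => q ^ (k ^ 2) := by
  have h : Summable fun n : ℕ => q ^ ((n : ℤ) ^ 2) := by
    refine (summable_geometric_of_lt_one h0.le h1).of_nonneg_of_le (fun n => by positivity)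
      fun n => ?_
    have : q ^ ((n : ℤ) ^ 2) = q ^ (n ^ 2) := by rw [← zpow_natCast]; push_cast; rfl
    rw [this]
    exact pow_le_pow_of_le_one h0.le h1.le (Nat.le_self_pow two_ne_zero n)
  exact Summable.of_nat_of_neg h (h.congr fun n => by rw [neg_sq])

/-- A qualitative form of the Jacobi triple product identity. -/
lemma exists_tendsto_prod_theta (h0 : 0 < q) (h1 : q < 1) :
    ∃ C, 0 < C ∧ ∀ y, Tendsto (fun N : ℕ =>
      ∏ i ∈ Finset.range N, (1 + q ^ (2 * (2 * i + 1)) + 2 * q ^ (2 * i + 1) * cos y)) atTop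
      (𝓝 (C * ∑' k : ℤ, q ^ (k ^ 2) * cos (k * y))) := by
  obtain ⟨L, hL, h⟩ := exists_tendsto_sqPoch h0 h1
  refine ⟨L⁻¹, by positivity, fun y => ?_⟩
  simp_rw [← fun N => (hasSum_tripleCoeff h0 h1 y N).tsum_eq]
  rw [← tsum_mul_left]
  refine tendsto_tsum_of_dominated_convergence
    (bound := fun k : ℤ => q ^ (k ^ 2) * (1 * L⁻¹ * L⁻¹))
    ((summable_zpow_sq h0 h1).mul_right _) (fun k => ?_) (Eventually.of_forall fun N k => ?_)
  · have h2 : Tendsto (fun N : ℕ => sqPoch q (2 * N)) atTop (𝓝 L) :=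
      h.comp (tendsto_id.const_mul_atTop' two_pos)
    have hm := tendsto_recSqPoch hL h (-k)
    simp only [← sub_eq_add_neg] at hm
    convert! (((h2.const_mul (q ^ (k ^ 2))).mul hm).mul (tendsto_recSqPoch hL h k)).mul_const
      (cos (k * y)) using 2
    field_simp
  · have hr (n : ℤ) := recSqPoch_nonneg h0 h1 n
    have hs := (sqPoch_pos h0 h1 (2 * N)).le
    have hs1 : sqPoch q (2 * N) ≤ 1 := by
      simpa [sqPoch] using sqPoch_antitone h0 h1 (Nat.zero_le (2 * N))
    have hc : 0 ≤ tripleCoeff q N k :=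
      mul_nonneg (mul_nonneg (by positivity) (hr _)) (hr _)
    rw [norm_mul, Real.norm_of_nonneg hc]
    refine (mul_le_of_le_one_right hc (abs_cos_le_one _)).trans ?_
    rw [tripleCoeff, mul_assoc, mul_assoc, mul_assoc 1]
    gcongr
    · exact mul_nonneg (hr _) (hr _)
    · exact hr _
    · exact recSqPoch_le h0 h1 hL h _
    · exact recSqPoch_le h0 h1 hL h _

lemma one_add_sq_add_cos_pos (h0 : 0 < q) (h1 : q < 1) (y : ℝ) :
    0 < 1 + q ^ 2 + 2 * q * cos y := by
  nlinarith [neg_one_le_cos y, mul_le_mul_of_nonneg_left (neg_one_le_cos y) h0.le]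

/-- The theta series divided by the first factor of its product expansion is monotone in `cos y`. -/
lemma theta_mul_le_theta_mul (h0 : 0 < q) (h1 : q < 1) {y z : ℝ} (h : cos z ≤ cos y) :
    (∑' k : ℤ, q ^ (k ^ 2) * cos (k * z)) * (1 + q ^ 2 + 2 * q * cos y)
      ≤ (∑' k : ℤ, q ^ (k ^ 2) * cos (k * y)) * (1 + q ^ 2 + 2 * q * cos z) := by
  obtain ⟨C, hC, hlim⟩ := exists_tendsto_prod_theta h0 h1
  have hl (y : ℝ) := (tendsto_add_atTop_iff_nat 1).2 (hlim y)
  have key := le_of_tendsto_of_tendsto' ((hl z).mul_const (1 + q ^ 2 + 2 * q * cos y))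
    ((hl y).mul_const (1 + q ^ 2 + 2 * q * cos z)) fun N => by
      have hle : ∏ i ∈ Finset.range N,
            (1 + q ^ (2 * (2 * (i + 1) + 1)) + 2 * q ^ (2 * (i + 1) + 1) * cos z)
          ≤ ∏ i ∈ Finset.range N,
            (1 + q ^ (2 * (2 * (i + 1) + 1)) + 2 * q ^ (2 * (i + 1) + 1) * cos y) := by
        refine Finset.prod_le_prod (fun i _ => ?_) fun i _ => by gcongr
        have := one_add_sq_add_cos_pos (pow_pos h0 (2 * (i + 1) + 1))
          (pow_lt_one₀ h0.le h1 (by lia)) z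
        rw [mul_comm 2 (2 * (i + 1) + 1), pow_mul]
        exact this.le
      rw [Finset.prod_range_succ', Finset.prod_range_succ']
      have hy := one_add_sq_add_cos_pos h0 h1 y
      have hz := one_add_sq_add_cos_pos h0 h1 z
      simp only [mul_zero, zero_add, mul_one, pow_one]
      nlinarith [mul_le_mul_of_nonneg_right hle (mul_pos hy hz).le]
  exact le_of_mul_le_mul_left (by simpa only [mul_assoc C] using key) hC

end TripleProduct

/-- The theta series `∑ₖ exp(-2(kx + k²t))`. -/
noncomputable def thetaSum (t x : ℝ) : ℝ :=
  ∑' k : ℤ, Real.exp (-2 * ((k : ℝ) * x + (k : ℝ) ^ 2 * t))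

/-- The series `∑ₖ k exp(-2(kx + k²t))`. -/
noncomputable def thetaSumMul (t x : ℝ) : ℝ :=
  ∑' k : ℤ, (k : ℝ) * Real.exp (-2 * ((k : ℝ) * x + (k : ℝ) ^ 2 * t))

section Theta

variable {t : ℝ}

lemma im_modulus_pos (ht : 0 < t) : 0 < (((2 * t / π : ℝ) : ℂ) * Complex.I).im := by
  rw [Complex.im_ofReal_mul, Complex.I_im]
  positivity

lemma jacobiTheta₂_term_eq_exp (t x : ℝ) (k : ℤ) :
    jacobiTheta₂_term k ((x / π : ℝ) * Complex.I) ((2 * t / π : ℝ) * Complex.I)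
      = (Real.exp (-2 * ((k : ℝ) * x + (k : ℝ) ^ 2 * t)) : ℝ) := by
  have hpi : (π : ℂ) ≠ 0 := by exact_mod_cast pi_ne_zero
  rw [jacobiTheta₂_term]
  push_cast
  congr 1
  field_simp
  linear_combination (k * x + k ^ 2 * t : ℂ) * Complex.I_sq

lemma jacobiTheta₂'_term_eq_exp (t x : ℝ) (k : ℤ) :
    jacobiTheta₂'_term k ((x / π : ℝ) * Complex.I) ((2 * t / π : ℝ) * Complex.I)
      = 2 * π * Complex.I *
        ((k * Real.exp (-2 * ((k : ℝ) * x + (k : ℝ) ^ 2 * t)) : ℝ) : ℂ) := by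
  rw [jacobiTheta₂'_term, jacobiTheta₂_term_eq_exp]
  push_cast
  ring

lemma hasSum_thetaSum (ht : 0 < t) (x : ℝ) :
    HasSum (fun k : ℤ => Real.exp (-2 * ((k : ℝ) * x + (k : ℝ) ^ 2 * t))) (thetaSum t x) := by
  have h := hasSum_jacobiTheta₂_term ((x / π : ℝ) * Complex.I) (im_modulus_pos ht)
  simp only [jacobiTheta₂_term_eq_exp] at h
  exact (Complex.summable_ofReal.1 h.summable).hasSum

lemma jacobiTheta₂_eq_thetaSum (ht : 0 < t) (x : ℝ) :
    jacobiTheta₂ ((x / π : ℝ) * Complex.I) ((2 * t / π : ℝ) * Complex.I) = thetaSum t x := by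
  have h := hasSum_jacobiTheta₂_term ((x / π : ℝ) * Complex.I) (im_modulus_pos ht)
  simp only [jacobiTheta₂_term_eq_exp] at h
  exact h.unique (Complex.hasSum_ofReal.2 (hasSum_thetaSum ht x))

lemma hasSum_thetaSumMul (ht : 0 < t) (x : ℝ) :
    HasSum (fun k : ℤ => (k : ℝ) * Real.exp (-2 * ((k : ℝ) * x + (k : ℝ) ^ 2 * t)))
      (thetaSumMul t x) := by
  have h := hasSum_jacobiTheta₂'_term ((x / π : ℝ) * Complex.I) (im_modulus_pos ht)
  simp only [jacobiTheta₂'_term_eq_exp] at h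
  exact (Complex.summable_ofReal.1 ((summable_mul_left_iff Complex.two_pi_I_ne_zero).1
    h.summable)).hasSum

lemma jacobiTheta₂'_eq_thetaSumMul (ht : 0 < t) (x : ℝ) :
    jacobiTheta₂' ((x / π : ℝ) * Complex.I) ((2 * t / π : ℝ) * Complex.I)
      = 2 * π * Complex.I * thetaSumMul t x := by
  have h := hasSum_jacobiTheta₂'_term ((x / π : ℝ) * Complex.I) (im_modulus_pos ht)
  simp only [jacobiTheta₂'_term_eq_exp] at h
  exact h.unique ((Complex.hasSum_ofReal.2 (hasSum_thetaSumMul ht x)).mul_left _)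

lemma hasDerivAt_thetaSum (ht : 0 < t) (x : ℝ) :
    HasDerivAt (thetaSum t) (-2 * thetaSumMul t x) x := by
  have hpi : (π : ℂ) ≠ 0 := by exact_mod_cast pi_ne_zero
  have h1 := hasDerivAt_jacobiTheta₂_fst ((x / π : ℝ) * Complex.I) (im_modulus_pos ht)
  have h2 : HasDerivAt (fun y : ℝ => ((y / π : ℝ) : ℂ) * Complex.I)
      ((1 / π : ℝ) * Complex.I) x :=
    (((hasDerivAt_id x).div_const π).ofReal_comp).mul_const _
  have h3 := h1.comp x h2
  have h4 : HasDerivAt (fun y : ℝ => (thetaSum t y : ℂ)) ((-2 * thetaSumMul t x : ℝ) : ℂ) x := by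
    convert! h3 using 1
    · ext y
      exact (jacobiTheta₂_eq_thetaSum ht y).symm
    · rw [jacobiTheta₂'_eq_thetaSumMul ht]
      push_cast
      field_simp
      rw [Complex.I_sq]
      ring
  exact Complex.reCLM.hasFDerivAt.comp_hasDerivAt x h4

lemma thetaSum_pos (ht : 0 < t) (x : ℝ) : 0 < thetaSum t x :=
  (hasSum_thetaSum ht x).summable.tsum_pos (fun _ => (Real.exp_pos _).le) 0 (Real.exp_pos _)

lemma continuous_thetaSum (ht : 0 < t) : Continuous (thetaSum t) :=
  continuous_iff_continuousAt.2 fun x => (hasDerivAt_thetaSum ht x).continuousAt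

lemma continuous_thetaSumMul (ht : 0 < t) : Continuous (thetaSumMul t) := by
  have h : Continuous fun x : ℝ => (2 * π * Complex.I * thetaSumMul t x : ℂ) := by
    simp only [← jacobiTheta₂'_eq_thetaSumMul ht]
    refine continuous_iff_continuousAt.2 fun x => ?_
    exact (continuousAt_jacobiTheta₂' _ (im_modulus_pos ht)).comp
      (f := fun x : ℝ => ((x / π : ℝ) * Complex.I, ((2 * t / π : ℝ) : ℂ) * Complex.I))
      (by fun_prop)
  refine (Complex.continuous_re.comp (continuous_const.mul h :
    Continuous fun x => (2 * π * Complex.I)⁻¹ * (2 * π * Complex.I * thetaSumMul t x))).congr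
    fun x => ?_
  simp only [Function.comp, Pi.mul_apply, inv_mul_cancel_left₀ Complex.two_pi_I_ne_zero,
    Complex.ofReal_re]

lemma phi0_eq (ht : 0 < t) (x : ℝ) : phi0 x t = x * thetaSum t x + 2 * t * thetaSumMul t x := by
  refine HasSum.tsum_eq ?_
  convert! ((hasSum_thetaSum ht x).mul_left x).add ((hasSum_thetaSumMul ht x).mul_left (2 * t))
    using 2 with k
  ring

lemma phi_eq (ht : t ≠ 0) (n : ℕ) (x : ℝ) :
    phi (n * π / t) x t
      = π / sinh (n * π / t * π) * (sin (n * (π * x / t)) * thetaSum t x) := by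
  rw [phi, thetaSum]
  refine congrArg _ (Eq.trans (tsum_congr fun k => ?_) tsum_mul_left)
  rw [show n * π / t * x + 2 * (k : ℝ) * (n * π / t) * t
    = n * (π * x / t) + ((k * n : ℤ) : ℝ) * (2 * π) by push_cast; field_simp]
  rw [sin_add_int_mul_two_pi]

lemma exists_thetaSum_eq (ht : 0 < t) : ∃ C, 0 < C ∧ ∀ x, thetaSum t x
    = C * exp (x ^ 2 / (2 * t)) *
      ∑' k : ℤ, exp (-π ^ 2 / (2 * t)) ^ (k ^ 2) * cos (k * (π * x / t)) := by
  refine ⟨1 / (2 * t / π) ^ (1 / 2 : ℝ), by positivity, fun x => ?_⟩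
  have hpi : (π : ℂ) ≠ 0 := by exact_mod_cast pi_ne_zero
  have htc : (t : ℂ) ≠ 0 := by exact_mod_cast ht.ne'
  have key := jacobiTheta₂_functional_equation ((x / π : ℝ) * Complex.I)
    ((2 * t / π : ℝ) * Complex.I)
  have hz : ((x / π : ℝ) * Complex.I) / ((2 * t / π : ℝ) * Complex.I) = (x / (2 * t) : ℝ) := by
    push_cast
    field_simp
  have hτ : -1 / ((2 * t / π : ℝ) * Complex.I) = (π / (2 * t) : ℝ) * Complex.I := by
    push_cast
    field_simp
    simp
  have hi : -Complex.I * ((2 * t / π : ℝ) * Complex.I) = (2 * t / π : ℝ) := by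
    push_cast
    field_simp
    simp
  have he : -π * Complex.I * ((x / π : ℝ) * Complex.I) ^ 2 / ((2 * t / π : ℝ) * Complex.I)
      = (x ^ 2 / (2 * t) : ℝ) := by
    push_cast
    field_simp
    simp
  rw [jacobiTheta₂_eq_thetaSum ht, hz, hτ, hi, he,
    show (1 / 2 : ℂ) = ((1 / 2 : ℝ) : ℂ) by push_cast; rfl,
    ← Complex.ofReal_cpow (by positivity), ← Complex.ofReal_exp, ← Complex.ofReal_one,
    ← Complex.ofReal_div, ← Complex.ofReal_mul] at key
  have hre := congrArg Complex.re key
  rw [Complex.re_ofReal_mul, Complex.ofReal_re] at hre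
  rw [hre]
  congr 1
  have him : 0 < (((π / (2 * t) : ℝ) : ℂ) * Complex.I).im := by
    rw [Complex.im_ofReal_mul, Complex.I_im]
    positivity
  have hsum := Complex.hasSum_re (hasSum_jacobiTheta₂_term ((x / (2 * t) : ℝ) : ℂ) him)
  refine hsum.tsum_eq.symm.trans (tsum_congr fun k => ?_)
  have harg : 2 * π * Complex.I * k * (x / (2 * t) : ℝ)
        + π * Complex.I * k ^ 2 * ((π / (2 * t) : ℝ) * Complex.I)
      = ((k ^ 2 : ℤ) * (-π ^ 2 / (2 * t)) : ℝ) + (k * (π * x / t) : ℝ) * Complex.I := by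
    push_cast
    field_simp
    linear_combination (π * k ^ 2 : ℂ) * Complex.I_sq
  rw [jacobiTheta₂_term, harg, Complex.exp_re, ← Real.rpow_intCast, ← Real.exp_mul,
    mul_comm (-π ^ 2 / (2 * t))]
  simp only [Complex.add_re, Complex.add_im, Complex.ofReal_re, Complex.ofReal_im,
    Complex.re_ofReal_mul, Complex.im_ofReal_mul, Complex.I_re, Complex.I_im, mul_zero, mul_one,
    add_zero, zero_add]

/-- The lower bound that gives integrability of the quotients `phi / phi0`. -/
lemma exists_sin_mul_thetaSum_le_phi0 (ht : 0 < t) :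
    ∃ c, 0 < c ∧ ∀ x ∈ Set.Ioo 0 t, c * (sin (π * x / t) * thetaSum t x) ≤ phi0 x t := by
  obtain ⟨C, hC, hθ⟩ := exists_thetaSum_eq ht
  set q := exp (-π ^ 2 / (2 * t)) with hq
  have h0 : 0 < q := exp_pos _
  have h1 : q < 1 := by
    rw [hq, Real.exp_lt_one_iff, neg_div]
    exact neg_neg_of_pos (by positivity)
  set B : ℝ → ℝ := fun x => 1 + q ^ 2 + 2 * q * cos (π * x / t)
  have hB (x : ℝ) : 0 < B x := one_add_sq_add_cos_pos h0 h1 _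
  refine ⟨2 * q * π / (1 + q) ^ 2, by positivity, fun x hx => ?_⟩
  have hanti : AntitoneOn (fun x => thetaSum t x * exp (-(x ^ 2 / (2 * t))) / B x)
      (Set.Icc 0 t) := by
    intro y hy z hz hyz
    have hcos : cos (π * z / t) ≤ cos (π * y / t) := by
      refine cos_le_cos_of_nonneg_of_le_pi (by have := hy.1; positivity) ?_ (by gcongr)
      rw [div_le_iff₀ ht]
      exact mul_le_mul_of_nonneg_left hz.2 pi_pos.le
    have key := theta_mul_le_theta_mul h0 h1 hcos
    have e (x : ℝ) : thetaSum t x * exp (-(x ^ 2 / (2 * t)))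
        = C * ∑' k : ℤ, q ^ (k ^ 2) * cos (k * (π * x / t)) := by
      rw [hθ, mul_right_comm, mul_assoc C, ← exp_add, add_neg_cancel, exp_zero, mul_one]
    simp only [e]
    rw [div_le_div_iff₀ (hB _) (hB _), mul_assoc, mul_assoc]
    exact mul_le_mul_of_nonneg_left key hC.le
  have hlin : HasDerivAt (fun x => π * x / t) (π / t) x := by
    simpa using ((hasDerivAt_id x).const_mul π).div_const t
  have hBd : HasDerivAt B (2 * q * (-sin (π * x / t) * (π / t))) x :=
    (hlin.cos.const_mul _).const_add _
  have hE : HasDerivAt (fun x => exp (-(x ^ 2 / (2 * t))))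
      (exp (-(x ^ 2 / (2 * t))) * -(x / t)) x := by
    convert! (((hasDerivAt_pow 2 x).div_const (2 * t)).neg).exp using 1
    field_simp
    norm_num
    ring
  have hder := ((hasDerivAt_thetaSum ht x).mul hE).div hBd (hB x).ne'
  have hneg := hder.hasDerivWithinAt.nonpos_of_antitoneOn
    ((isPreconnected_Icc.preperfect_of_nontrivial ⟨0, by simp [ht.le], t, by simp [ht.le], ht.ne⟩)
      x ⟨hx.1.le, hx.2.le⟩) hanti
  have hsin : 0 < sin (π * x / t) := by
    refine sin_pos_of_pos_of_lt_pi (by have := hx.1; positivity) ?_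
    rw [div_lt_iff₀ ht]
    exact mul_lt_mul_of_pos_left hx.2 pi_pos
  have hBle : B x ≤ (1 + q) ^ 2 := by
    have := mul_le_of_le_one_right (by positivity : 0 ≤ 2 * q) (cos_le_one (π * x / t))
    simp only [B]
    linarith
  have hpos := hB x
  have hT := thetaSum_pos ht x
  rw [div_le_iff₀ (by positivity), zero_mul, Pi.mul_apply] at hneg
  generalize hb : B x = b at *
  have hmain : 2 * q * π * (sin (π * x / t) * thetaSum t x) ≤ phi0 x t * b := by
    have hexp := exp_pos (-(x ^ 2 / (2 * t)))
    generalize exp (-(x ^ 2 / (2 * t))) = E at *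
    rw [phi0_eq ht]
    have : E / t * (2 * q * π * (sin (π * x / t) * thetaSum t x)
        - (x * thetaSum t x + 2 * t * thetaSumMul t x) * b) ≤ 0 := by
      refine le_trans (le_of_eq ?_) hneg
      field_simp
      ring
    have := nonpos_of_mul_nonpos_right this (by positivity)
    linarith
  have hφ : 0 ≤ phi0 x t := by
    refine nonneg_of_mul_nonneg_left (le_trans (by positivity) hmain) hpos
  rw [div_mul_eq_mul_div, div_le_iff₀ (by positivity)]
  exact hmain.trans (mul_le_mul_of_nonneg_left hBle hφ)

end Theta

section Moments

open Polynomial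

lemma span_chebyshev_U_eq_top :
    Submodule.span ℝ (Set.range fun n : ℕ => Chebyshev.U ℝ n) = ⊤ := by
  set S := Submodule.span ℝ (Set.range fun n : ℕ => Chebyshev.U ℝ n) with hS
  have hU (n : ℕ) : Chebyshev.U ℝ n ∈ S := Submodule.subset_span ⟨n, rfl⟩
  have hX : ∀ p ∈ S, X * p ∈ S := by
    intro p hp
    induction hp using Submodule.span_induction with
    | mem p hp =>
      obtain ⟨n, rfl⟩ := hp
      have h2 : (C (2 : ℝ)) * C (1 / 2 : ℝ) = 1 := by rw [← C_mul]; norm_num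
      rcases n with _ | n
      · have h : X * Chebyshev.U ℝ (0 : ℕ) = (1 / 2 : ℝ) • Chebyshev.U ℝ (1 : ℕ) := by
          simp only [Nat.cast_zero, Chebyshev.U_zero, Nat.cast_one, Chebyshev.U_one, smul_eq_C_mul]
          rw [← C_ofNat]
          linear_combination (-X : ℝ[X]) * h2
        exact h ▸ S.smul_mem _ (hU 1)
      · have h : X * Chebyshev.U ℝ (n + 1 : ℕ)
            = (1 / 2 : ℝ) • (Chebyshev.U ℝ (n + 2 : ℕ) + Chebyshev.U ℝ n) := by
          have := Chebyshev.U_add_two ℝ n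
          rw [← C_ofNat] at this
          push_cast
          rw [this, smul_eq_C_mul]
          linear_combination (-X * Chebyshev.U ℝ (n + 1)) * h2
        exact h ▸ S.smul_mem _ (S.add_mem (hU _) (hU _))
    | zero => simp
    | add p q _ _ hp hq => rw [mul_add]; exact S.add_mem hp hq
    | smul a p _ hp => rw [mul_smul_comm]; exact S.smul_mem a hp
  have hpow (n : ℕ) : (X : ℝ[X]) ^ n ∈ S := by
    induction n with
    | zero => simpa using hU 0
    | succ n ih => rw [pow_succ']; exact hX _ ih
  refine Submodule.eq_top_iff'.2 fun p => ?_
  rw [p.as_sum_range_C_mul_X_pow]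
  exact S.sum_mem fun n _ => by rw [← smul_eq_C_mul]; exact S.smul_mem _ (hpow n)

/-- Two finite measures on `(0, t)` with the same integrals against `sin((n+1)πx/t) / sin(πx/t)`
coincide. -/
lemma measure_eq_of_integral_U_eq {t : ℝ} (ht : 0 < t) {μ ν : Measure ℝ}
    [IsFiniteMeasure μ] [IsFiniteMeasure ν]
    (hμ : μ (Set.Ioo 0 t)ᶜ = 0) (hν : ν (Set.Ioo 0 t)ᶜ = 0)
    (h : ∀ n : ℕ, ∫ x, (Chebyshev.U ℝ n).eval (cos (π * x / t)) ∂μ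
      = ∫ x, (Chebyshev.U ℝ n).eval (cos (π * x / t)) ∂ν) : μ = ν := by
  have hint (m : Measure ℝ) [IsFiniteMeasure m] (p : ℝ[X]) :
      Integrable (fun x => p.eval (cos (π * x / t))) m := by
    obtain ⟨K, hK⟩ := isCompact_Icc.exists_bound_of_continuousOn
      (f := fun u => p.eval u) (s := Set.Icc (-1 : ℝ) 1) p.continuous.continuousOn
    refine Integrable.of_bound (C := K) ?_ (Eventually.of_forall fun x => hK _ (cos_mem_Icc _))
    exact (p.continuous.comp (by fun_prop)).aestronglyMeasurable
  have hpoly (p : ℝ[X]) :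
      ∫ x, p.eval (cos (π * x / t)) ∂μ = ∫ x, p.eval (cos (π * x / t)) ∂ν := by
    have hp : p ∈ Submodule.span ℝ (Set.range fun n : ℕ => Chebyshev.U ℝ n) := by
      rw [span_chebyshev_U_eq_top]; trivial
    induction hp using Submodule.span_induction with
    | mem p hp => obtain ⟨n, rfl⟩ := hp; exact h n
    | zero => simp
    | add p q _ _ hp hq =>
      simp only [eval_add]
      rw [integral_add (hint _ _) (hint _ _), integral_add (hint _ _) (hint _ _), hp, hq]
    | smul a p _ hp => simp only [eval_smul, integral_smul, hp]
  refine ext_of_forall_integral_eq_of_IsFiniteMeasure fun f => ?_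
  refine eq_of_forall_dist_le fun ε hε => ?_
  set K : ℝ := μ.real Set.univ + ν.real Set.univ with hK
  have hK0 : 0 ≤ K := by positivity
  obtain ⟨p, hp⟩ := exists_polynomial_near_of_continuousOn (-1) 1
    (fun u => f (t / π * arccos u)) (by fun_prop) (ε / (K + 1)) (by positivity)
  have hclose (m : Measure ℝ) [IsFiniteMeasure m] (hm : m (Set.Ioo 0 t)ᶜ = 0) :
      dist (∫ x, f x ∂m) (∫ x, p.eval (cos (π * x / t)) ∂m)
        ≤ ε / (K + 1) * m.real Set.univ := by
    rw [dist_eq_norm, ← integral_sub (f.integrable m) (hint _ _)]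
    refine norm_integral_le_of_norm_le_const ?_
    filter_upwards [mem_ae_iff.2 hm] with x hx
    have := (hp _ (cos_mem_Icc (π * x / t))).le
    rw [arccos_cos (by have := hx.1; positivity)
      (by rw [div_le_iff₀ ht]; exact mul_le_mul_of_nonneg_left hx.2.le pi_pos.le),
      show t / π * (π * x / t) = x by field_simp] at this
    rwa [norm_sub_rev, Real.norm_eq_abs]
  calc dist (∫ x, f x ∂μ) (∫ x, f x ∂ν)
      ≤ ε / (K + 1) * μ.real Set.univ + ε / (K + 1) * ν.real Set.univ := by
        refine (dist_triangle_right _ _ (∫ x, p.eval (cos (π * x / t)) ∂μ)).trans ?_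
        refine add_le_add (hclose μ hμ) ?_
        rw [hpoly]
        exact hclose ν hν
    _ = ε * (K / (K + 1)) := by rw [hK]; ring
    _ ≤ ε := mul_le_of_le_one_right hε.le (div_le_one_of_le₀ (by linarith) (by linarith))

end Moments

/-- Let `t > 0`. If `μ` and `ν` are Borel probability measures on `ℝ` supported in `(0,t)` such
that `∫ φ_{nπ/t}(x,t)/φ_0(x,t) dμ(x) = ∫ φ_{nπ/t}(x,t)/φ_0(x,t) dν(x)` for every positive
integer `n`, then `μ = ν`. -/
theorem measure_eq_of_integrals_eq (t : ℝ) (ht : 0 < t) (μ ν : Measure ℝ)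
    [IsProbabilityMeasure μ] [IsProbabilityMeasure ν]
    (hμ : μ (Set.Ioo 0 t)ᶜ = 0) (hν : ν (Set.Ioo 0 t)ᶜ = 0)
    (h : ∀ n : ℕ, 0 < n →
      ∫ x, phi ((n : ℝ) * Real.pi / t) x t / phi0 x t ∂μ
        = ∫ x, phi ((n : ℝ) * Real.pi / t) x t / phi0 x t ∂ν) :
    μ = ν := by
  obtain ⟨c, hc, hle⟩ := exists_sin_mul_thetaSum_le_phi0 ht
  set G : ℝ → ℝ := fun x => sin (π * x / t) * thetaSum t x / phi0 x t with hG
  have hsin {x : ℝ} (hx : x ∈ Set.Ioo 0 t) : 0 < sin (π * x / t) := by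
    refine sin_pos_of_pos_of_lt_pi (by have := hx.1; positivity) ?_
    rw [div_lt_iff₀ ht]
    exact mul_lt_mul_of_pos_left hx.2 pi_pos
  have hnum {x : ℝ} (hx : x ∈ Set.Ioo 0 t) : 0 < sin (π * x / t) * thetaSum t x :=
    mul_pos (hsin hx) (thetaSum_pos ht x)
  have hphi {x : ℝ} (hx : x ∈ Set.Ioo 0 t) : 0 < phi0 x t :=
    (mul_pos hc (hnum hx)).trans_le (hle x hx)
  have hGpos {x : ℝ} (hx : x ∈ Set.Ioo 0 t) : 0 < G x := div_pos (hnum hx) (hphi hx)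
  have hGle {x : ℝ} (hx : x ∈ Set.Ioo 0 t) : G x ≤ c⁻¹ := by
    rw [hG, div_le_iff₀ (hphi hx), inv_mul_eq_div, le_div_iff₀' hc]
    exact hle x hx
  have hGm : Measurable G := by
    have h1 := (continuous_thetaSum ht).measurable
    have h2 := (continuous_thetaSumMul ht).measurable
    simp only [hG, phi0_eq ht]
    fun_prop
  set g : ℝ → ENNReal := fun x => ENNReal.ofReal (G x) with hg
  have hgm : Measurable g := hGm.ennreal_ofReal
  have hfin (m : Measure ℝ) [IsProbabilityMeasure m] (hm : m (Set.Ioo 0 t)ᶜ = 0) :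
      IsFiniteMeasure (m.withDensity g) := by
    refine isFiniteMeasure_withDensity_ofReal ?_
    refine (Integrable.of_bound (C := c⁻¹) hGm.aestronglyMeasurable ?_).2
    filter_upwards [mem_ae_iff.2 hm] with x hx
    rw [Real.norm_of_nonneg (hGpos hx).le]
    exact hGle hx
  have hinv (m : Measure ℝ) (hm : m (Set.Ioo 0 t)ᶜ = 0) :
      (m.withDensity g).withDensity (fun x => (g x)⁻¹) = m := by
    refine withDensity_inv_same hgm ?_ (Eventually.of_forall fun x => ENNReal.ofReal_ne_top)
    filter_upwards [mem_ae_iff.2 hm] with x hx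
    exact (ENNReal.ofReal_pos.2 (hGpos hx)).ne'
  have hU (m : Measure ℝ) (hm : m (Set.Ioo 0 t)ᶜ = 0) (n : ℕ) :
      ∫ x, phi ((n + 1 : ℕ) * π / t) x t / phi0 x t ∂m
        = π / sinh ((n + 1 : ℕ) * π / t * π) *
          ∫ x, (Polynomial.Chebyshev.U ℝ n).eval (cos (π * x / t)) ∂(m.withDensity g) := by
    rw [integral_withDensity_eq_integral_toReal_smul hgm
      (Eventually.of_forall fun x => ENNReal.ofReal_lt_top), ← integral_const_mul]
    refine integral_congr_ae ?_
    filter_upwards [mem_ae_iff.2 hm] with x hx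
    rw [hg, ENNReal.toReal_ofReal (hGpos hx).le, phi_eq ht.ne', hG]
    have := Polynomial.Chebyshev.U_real_cos (π * x / t) n
    push_cast at this ⊢
    rw [← this, smul_eq_mul]
    ring
  have hac (m : Measure ℝ) (hm : m (Set.Ioo 0 t)ᶜ = 0) :
      m.withDensity g (Set.Ioo 0 t)ᶜ = 0 := withDensity_absolutelyContinuous m g hm
  have := hfin μ hμ
  have := hfin ν hν
  rw [← hinv μ hμ, ← hinv ν hν]
  congr 1
  refine measure_eq_of_integral_U_eq ht (hac μ hμ) (hac ν hν) fun n => ?_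
  have hn := h (n + 1) n.succ_pos
  rw [hU μ hμ, hU ν hν] at hn
  refine mul_left_cancel₀ (div_ne_zero pi_ne_zero (sinh_ne_zero.2 ?_)) hn
  positivity
end

section
/- Let u > 0, x ∈ ℝ, and let (B_s)_{s≥0} be a standard one-dimensional Brownian motion starting from x with respect to a filtration (F_s)_{s≥0}. Then the process (φ_0(B_s, s + u))_{s≥0} is a true martingale with respect to (F_s): each φ_0(B_s, s+u) is integrable and E[φ_0(B_{s'}, s' + u) | F_s] = φ_0(B_s, s + u) almost surely for all 0 ≤ s ≤ s'. -/
open Real Filter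

open MeasureTheory ProbabilityTheory
open scoped NNReal

lemma summable_exp_linear_sub_sq (a b : ℝ) {u : ℝ} (hu : 0 < u) :
    Summable fun k : ℤ => Real.exp (a + b * k - 2 * u * (k : ℝ) ^ 2) := by
  have hT : 0 < 2 * u / Real.pi := by positivity
  have hsum := (summable_pow_mul_jacobiTheta₂_term_bound (|b| / (2 * Real.pi)) hT 0).mul_left
    (Real.exp a)
  refine hsum.of_nonneg_of_le (fun k => (Real.exp_pos _).le) fun k => ?_
  rw [pow_zero, one_mul, ← Real.exp_add, Real.exp_le_exp]
  have hpi : Real.pi ≠ 0 := Real.pi_ne_zero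
  have hbk : b * k ≤ |b| * |(k : ℝ)| := by
    rw [← abs_mul]
    exact le_abs_self _
  have hexp : -Real.pi * (2 * u / Real.pi * (k : ℝ) ^ 2 - 2 * (|b| / (2 * Real.pi)) * |(k : ℝ)|)
      = |b| * |(k : ℝ)| - 2 * u * (k : ℝ) ^ 2 := by
    field_simp
    ring
  push_cast
  rw [hexp]
  linarith

lemma abs_le_exp_add_exp_neg (w : ℝ) : |w| ≤ Real.exp w + Real.exp (-w) := by
  have h₁ := Real.add_one_le_exp w
  have h₂ := Real.add_one_le_exp (-w)
  have h₃ := Real.exp_pos w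
  have h₄ := Real.exp_pos (-w)
  rw [abs_le]
  constructor <;> linarith

/-- The `k`-th summand of `φ_0`. -/
noncomputable def phi0Term (k : ℤ) (y t : ℝ) : ℝ :=
  (y + 2 * (k : ℝ) * t) * Real.exp (-2 * ((k : ℝ) * y + (k : ℝ) ^ 2 * t))

lemma phi0_eq_tsum (y t : ℝ) : phi0 y t = ∑' k : ℤ, phi0Term k y t := rfl

lemma norm_phi0Term_le (k : ℤ) (y t : ℝ) :
    ‖phi0Term k y t‖ ≤
      Real.exp (y + 2 * k * t - 2 * (k * y + (k : ℝ) ^ 2 * t)) +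
        Real.exp (-(y + 2 * k * t) - 2 * (k * y + (k : ℝ) ^ 2 * t)) := by
  rw [phi0Term, norm_mul, Real.norm_eq_abs, Real.norm_of_nonneg (Real.exp_pos _).le,
    sub_eq_add_neg, Real.exp_add (y + 2 * k * t), sub_eq_add_neg,
    Real.exp_add (-(y + 2 * k * t)), ← add_mul, neg_mul]
  gcongr
  exact abs_le_exp_add_exp_neg _

lemma summable_phi0Term (y : ℝ) {t : ℝ} (ht : 0 < t) : Summable fun k : ℤ => phi0Term k y t := by
  refine Summable.of_norm_bounded
    ((summable_exp_linear_sub_sq y (2 * t - 2 * y) ht).add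
      (summable_exp_linear_sub_sq (-y) (-2 * t - 2 * y) ht)) fun k => ?_
  convert norm_phi0Term_le k y t using 3 <;> ring

lemma measurable_phi0Term (k : ℤ) (t : ℝ) : Measurable fun y => phi0Term k y t := by
  unfold phi0Term
  fun_prop

lemma measurable_phi0 {t : ℝ} (ht : 0 < t) : Measurable fun y => phi0 y t := by
  refine measurable_of_tendsto_metrizable' (atTop : Filter (Finset ℤ))
    (f := fun s y => ∑ k ∈ s, phi0Term k y t)
    (fun s => Finset.measurable_fun_sum s fun k _ => measurable_phi0Term k t) ?_
  rw [tendsto_pi_nhds]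
  exact fun y => (summable_phi0Term y ht).hasSum

lemma integral_exp_mul_gaussianReal (v : ℝ≥0) (c : ℝ) :
    ∫ z, Real.exp (c * z) ∂(gaussianReal 0 v) = Real.exp (v * c ^ 2 / 2) := by
  have h := congrFun (mgf_fun_id_gaussianReal (μ := 0) (v := v)) c
  simpa [mgf] using h

lemma integrable_id_mul_exp_mul_gaussianReal (v : ℝ≥0) (c : ℝ) :
    Integrable (fun z => z * Real.exp (c * z)) (gaussianReal 0 v) := by
  have h := integrable_pow_mul_exp_of_mem_interior_integrableExpSet
    (X := fun z : ℝ => z) (μ := gaussianReal 0 v) (v := c)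
    (by simp [integrableExpSet_fun_id_gaussianReal]) 1
  simpa using h

lemma integral_id_mul_exp_mul_gaussianReal (v : ℝ≥0) (c : ℝ) :
    ∫ z, z * Real.exp (c * z) ∂(gaussianReal 0 v) = c * v * Real.exp (v * c ^ 2 / 2) := by
  have h := deriv_mgf (X := fun z : ℝ => z) (μ := gaussianReal 0 v) (t := c)
    (by simp [integrableExpSet_fun_id_gaussianReal])
  rw [← h, mgf_fun_id_gaussianReal]
  have hd : HasDerivAt (fun t : ℝ => Real.exp (0 * t + v * t ^ 2 / 2))
      (Real.exp (0 * c + v * c ^ 2 / 2) * (0 * 1 + v * (2 * c) / 2)) c := by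
    have hsq : HasDerivAt (fun t : ℝ => t ^ 2) (2 * c) c := by simpa using hasDerivAt_pow 2 c
    exact ((((hasDerivAt_id c).const_mul 0).add ((hsq.const_mul (v : ℝ)).div_const 2))).exp
  rw [hd.deriv, zero_mul, zero_add]
  ring

lemma phi0Term_add (k : ℤ) (y z t : ℝ) :
    phi0Term k (y + z) t =
      Real.exp (-2 * (k * y + (k : ℝ) ^ 2 * t)) *
        ((y + 2 * k * t) * Real.exp (-2 * k * z) + z * Real.exp (-2 * k * z)) := by
  rw [phi0Term, show -2 * ((k : ℝ) * (y + z) + (k : ℝ) ^ 2 * t)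
    = -2 * (k * y + (k : ℝ) ^ 2 * t) + -2 * k * z by ring, Real.exp_add]
  ring

lemma integrable_phi0Term_add (k : ℤ) (y t : ℝ) (v : ℝ≥0) :
    Integrable (fun z => phi0Term k (y + z) t) (gaussianReal 0 v) := by
  simp_rw [phi0Term_add]
  exact (((integrable_exp_mul_gaussianReal _).const_mul _).add
    (integrable_id_mul_exp_mul_gaussianReal v _)).const_mul _

lemma integral_phi0Term_add (k : ℤ) (y t : ℝ) (v : ℝ≥0) :
    ∫ z, phi0Term k (y + z) (t + v) ∂(gaussianReal 0 v) = phi0Term k y t := by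
  simp_rw [phi0Term_add]
  rw [integral_const_mul, integral_add ((integrable_exp_mul_gaussianReal _).const_mul _)
    (integrable_id_mul_exp_mul_gaussianReal v _), integral_const_mul,
    integral_exp_mul_gaussianReal, integral_id_mul_exp_mul_gaussianReal, ← add_mul,
    mul_left_comm, ← Real.exp_add, phi0Term]
  congr 1
  · ring
  · congr 1
    ring

lemma integral_norm_phi0Term_add_le (k : ℤ) (y t : ℝ) (v : ℝ≥0) :
    ∫ z, ‖phi0Term k (y + z) (t + v)‖ ∂(gaussianReal 0 v) ≤
      Real.exp (y + v / 2 + (2 * t - 2 * y) * k - 2 * t * (k : ℝ) ^ 2) +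
        Real.exp (-y + v / 2 + (-2 * t - 2 * y) * k - 2 * t * (k : ℝ) ^ 2) := by
  set a₁ : ℝ := (1 - 2 * k) * y + 2 * k * (t + v) - 2 * (k : ℝ) ^ 2 * (t + v)
  set a₂ : ℝ := (-1 - 2 * k) * y - 2 * k * (t + v) - 2 * (k : ℝ) ^ 2 * (t + v)
  have hint₁ : Integrable (fun z => Real.exp a₁ * Real.exp ((1 - 2 * k) * z))
      (gaussianReal 0 v) := (integrable_exp_mul_gaussianReal _).const_mul _
  have hint₂ : Integrable (fun z => Real.exp a₂ * Real.exp ((-1 - 2 * k) * z))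
      (gaussianReal 0 v) := (integrable_exp_mul_gaussianReal _).const_mul _
  calc
    ∫ z, ‖phi0Term k (y + z) (t + v)‖ ∂(gaussianReal 0 v)
      ≤ ∫ z, (Real.exp a₁ * Real.exp ((1 - 2 * k) * z) +
          Real.exp a₂ * Real.exp ((-1 - 2 * k) * z)) ∂(gaussianReal 0 v) := by
        refine integral_mono (integrable_phi0Term_add k y _ v).norm (hint₁.add hint₂) fun z => ?_
        refine (norm_phi0Term_le k (y + z) (t + v)).trans_eq ?_
        rw [← Real.exp_add, ← Real.exp_add]
        congr 2 <;> ring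
    _ = _ := by
        rw [integral_add hint₁ hint₂, integral_const_mul, integral_const_mul,
          integral_exp_mul_gaussianReal, integral_exp_mul_gaussianReal, ← Real.exp_add,
          ← Real.exp_add]
        congr 2 <;> ring

lemma summable_integral_norm_phi0Term_add (y : ℝ) {t : ℝ} (ht : 0 < t) (v : ℝ≥0) :
    Summable fun k : ℤ => ∫ z, ‖phi0Term k (y + z) (t + v)‖ ∂(gaussianReal 0 v) :=
  ((summable_exp_linear_sub_sq _ _ ht).add (summable_exp_linear_sub_sq _ _ ht)).of_nonneg_of_le
    (fun _ => integral_nonneg fun _ => norm_nonneg _)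
    fun k => integral_norm_phi0Term_add_le k y t v

lemma integrable_tsum_of_summable_integral_norm {α ι : Type*} [MeasurableSpace α] [Countable ι]
    {μ : Measure α} {f : ι → α → ℝ} (hf : ∀ i, Integrable (f i) μ)
    (hsum : Summable fun i => ∫ a, ‖f i a‖ ∂μ)
    (hmeas : AEStronglyMeasurable (fun a => ∑' i, f i a) μ) :
    Integrable (fun a => ∑' i, f i a) μ := by
  refine ⟨hmeas, ?_⟩
  calc
    ∫⁻ a, ‖∑' i, f i a‖ₑ ∂μ ≤ ∫⁻ a, ∑' i, ‖f i a‖ₑ ∂μ :=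
      lintegral_mono fun a => enorm_tsum_le_tsum_enorm
    _ = ∑' i, ENNReal.ofReal (∫ a, ‖f i a‖ ∂μ) := by
      rw [lintegral_tsum fun i => (hf i).1.enorm]
      exact tsum_congr fun i => (ofReal_integral_norm_eq_lintegral_enorm (hf i)).symm
    _ < ⊤ := hsum.tsum_ofReal_lt_top

lemma integrable_phi0_add (y : ℝ) {t : ℝ} (ht : 0 < t) (v : ℝ≥0) :
    Integrable (fun z => phi0 (y + z) (t + v)) (gaussianReal 0 v) :=
  integrable_tsum_of_summable_integral_norm (fun k => integrable_phi0Term_add k y _ v)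
    (summable_integral_norm_phi0Term_add y ht v)
    ((measurable_phi0 (by positivity : 0 < t + v)).comp
      (measurable_const_add y)).aestronglyMeasurable

/-- `φ_0` is a space-time harmonic function for the heat semigroup. -/
lemma integral_phi0_add (y : ℝ) {t : ℝ} (ht : 0 < t) (v : ℝ≥0) :
    ∫ z, phi0 (y + z) (t + v) ∂(gaussianReal 0 v) = phi0 y t := by
  simp_rw [phi0_eq_tsum]
  rw [← integral_tsum_of_summable_integral_norm (fun k => integrable_phi0Term_add k y _ v)
    (summable_integral_norm_phi0Term_add y ht v)]
  exact tsum_congr fun k => integral_phi0Term_add k y t v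

lemma condExp_comp_add_of_indep {Ω : Type*} {m m₀ : MeasurableSpace Ω} {P : Measure Ω}
    [IsProbabilityMeasure P] (hm : m ≤ m₀) {X Y : Ω → ℝ} (hX : Measurable[m] X)
    (hY : Measurable Y) (hind : Indep (MeasurableSpace.comap Y inferInstance) m P)
    {f g : ℝ → ℝ} (hf : Measurable f) (hg : Measurable g)
    (hfint : Integrable (fun ω => f (X ω)) P) (hgint : Integrable (fun ω => g (X ω + Y ω)) P)
    (hfg : ∀ y, ∫ z, g (y + z) ∂(P.map Y) = f y) :
    P[fun ω => g (X ω + Y ω) | m] =ᵐ[P] fun ω => f (X ω) := by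
  refine (ae_eq_condExp_of_forall_setIntegral_eq hm hgint (fun _ _ _ => hfint.integrableOn)
    (fun A hA _ => ?_) (hf.comp hX).stronglyMeasurable.aestronglyMeasurable).symm
  have hWm : Measurable[m] fun ω => (A.indicator (fun _ => (1 : ℝ)) ω, X ω) :=
    (measurable_const.indicator hA).prodMk hX
  set W : Ω → ℝ × ℝ := fun ω => (A.indicator (fun _ => (1 : ℝ)) ω, X ω) with hWdef
  have hW : Measurable W := hWm.mono hm le_rfl
  have hWY : IndepFun W Y P := by
    rw [IndepFun_iff_Indep]
    exact indep_of_indep_of_le_left hind.symm hWm.comap_le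
  have hmap := hWY.map_prod_eq_prod_map_map hW.aemeasurable hY.aemeasurable
  have : IsProbabilityMeasure (P.map Y) := Measure.isProbabilityMeasure_map hY.aemeasurable
  have : IsProbabilityMeasure (P.map W) := Measure.isProbabilityMeasure_map hW.aemeasurable
  let h : (ℝ × ℝ) × ℝ → ℝ := fun p => p.1.1 * g (p.1.2 + p.2)
  have hh : Measurable h := by fun_prop
  have hcomp (ω : Ω) : h (W ω, Y ω) = A.indicator (fun ω => g (X ω + Y ω)) ω := by
    by_cases hω : ω ∈ A <;> simp [h, hWdef, hω]
  have hhint : Integrable h (P.map fun ω => (W ω, Y ω)) := by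
    rw [integrable_map_measure hh.aestronglyMeasurable (hW.prodMk hY).aemeasurable]
    exact (hgint.indicator (hm _ hA)).congr (ae_of_all _ fun ω => (hcomp ω).symm)
  have hfW : Measurable fun w : ℝ × ℝ => w.1 * f w.2 := by fun_prop
  calc
    ∫ ω in A, f (X ω) ∂P = ∫ ω, (W ω).1 * f (W ω).2 ∂P := by
      rw [← integral_indicator (hm _ hA)]
      refine integral_congr_ae (ae_of_all _ fun ω => ?_)
      by_cases hω : ω ∈ A <;> simp [hWdef, hω]
    _ = ∫ w, w.1 * f w.2 ∂(P.map W) :=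
      (integral_map hW.aemeasurable hfW.aestronglyMeasurable).symm
    _ = ∫ w, ∫ z, h (w, z) ∂(P.map Y) ∂(P.map W) := by
      simp only [h, integral_const_mul, hfg]
    _ = ∫ p, h p ∂(P.map fun ω => (W ω, Y ω)) := by
      rw [hmap] at hhint ⊢
      exact (integral_prod h hhint).symm
    _ = ∫ ω, h (W ω, Y ω) ∂P :=
      integral_map (hW.prodMk hY).aemeasurable hh.aestronglyMeasurable
    _ = ∫ ω in A, g (X ω + Y ω) ∂P := by
      simp_rw [hcomp]
      exact integral_indicator (hm _ hA)

/-- Let `u > 0`, `x ∈ ℝ`, and let `(B_s)_{s ≥ 0}` be a standard one-dimensional Brownian motion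
starting from `x` with respect to a filtration `(F_s)_{s ≥ 0}`: it is adapted, has a.s. continuous
paths, `B_0 = x` a.s., and for `s ≤ s'` the increment `B_{s'} − B_s` is independent of `F_s` and
Gaussian with mean `0` and variance `s' − s`. Then `(φ_0(B_s, s + u))_{s ≥ 0}` is a true
martingale: each `φ_0(B_s, s + u)` is integrable and
`E[φ_0(B_{s'}, s' + u) | F_s] = φ_0(B_s, s + u)` a.s. for all `s ≤ s'`. -/
theorem phi0_martingale {Ω : Type*} [m : MeasurableSpace Ω] {P : Measure Ω}
    [IsProbabilityMeasure P] (F : Filtration ℝ≥0 m) (B : ℝ≥0 → Ω → ℝ) (x u : ℝ) (hu : 0 < u)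
    (hadapted : Adapted F B)
    (hcont : ∀ᵐ ω ∂P, Continuous fun s : ℝ≥0 => B s ω)
    (hstart : ∀ᵐ ω ∂P, B 0 ω = x)
    (hgauss : ∀ s s' : ℝ≥0, s ≤ s' →
      Measure.map (fun ω => B s' ω - B s ω) P = gaussianReal 0 (s' - s))
    (hindep : ∀ s s' : ℝ≥0, s ≤ s' →
      Indep (MeasurableSpace.comap (fun ω => B s' ω - B s ω) Real.measurableSpace) (F s) P) :
    (∀ s : ℝ≥0, Integrable (fun ω => phi0 (B s ω) ((s : ℝ) + u)) P) ∧
    Martingale (fun (s : ℝ≥0) (ω : Ω) => phi0 (B s ω) ((s : ℝ) + u)) F P := by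
  have hB (s : ℝ≥0) : Measurable (B s) := (hadapted s).mono (F.le s) le_rfl
  have hpos (s : ℝ≥0) : 0 < (s : ℝ) + u := by positivity
  have hint (s : ℝ≥0) : Integrable (fun ω => phi0 (B s ω) ((s : ℝ) + u)) P := by
    have hlaw := integrable_phi0_add x hu s
    have hmap := hgauss 0 s zero_le
    rw [tsub_zero] at hmap
    rw [← hmap] at hlaw
    refine (hlaw.comp_measurable ((hB s).sub (hB 0))).congr ?_
    filter_upwards [hstart] with ω hω
    simp [hω, add_comm u]
  refine ⟨hint, fun s => ((measurable_phi0 (hpos s)).comp (hadapted s)).stronglyMeasurable,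
    fun s s' hss => ?_⟩
  have hcond := condExp_comp_add_of_indep (F.le s) (hadapted s) ((hB s').sub (hB s))
    (hindep s s' hss) (measurable_phi0 (hpos s)) (measurable_phi0 (hpos s')) (hint s)
    (by simpa using hint s') fun y => by
      have hheat := integral_phi0_add y (hpos s) (s' - s)
      rw [NNReal.coe_sub hss, show (s : ℝ) + u + (s' - s) = s' + u by ring] at hheat
      exact (congrArg (fun ν => ∫ z, phi0 (y + z) (s' + u) ∂ν) (hgauss s s' hss)).trans hheat
  simpa using hcond
end

section
/- Let u > 0, 0 < x < u, 0 ≤ y ≤ u and t > 0. Then the limit as c → 0⁺ of φ_0(c·y, c²·t + c·u) / φ_0(c·x, c·u) equals (sin(πy/u) / sin(πx/u)) · exp(π²t/(2u²)). (Equivalently, writing φ_0^{(c)}(z,s) = φ_0(cz, c²s), one has lim_{c→0⁺} φ_0^{(c)}(y, t + u/c) / φ_0^{(c)}(x, u/c) = (sin(πy/u)/sin(πx/u)) · exp(π²t/(2u²)).) -/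
open Real Filter

/-- Poisson summation for `phi0`: the Jacobi functional equation turns the series into
a theta derivative at the dual modulus. -/
lemma ofReal_phi0_eq_jacobiTheta₂' (x : ℝ) {t : ℝ} (ht : 0 < t) :
    (phi0 x t : ℂ) = ((-(1 / 2) * ((√(2 * t / π))⁻¹ * Real.exp (x ^ 2 / (2 * t))) : ℝ) : ℂ) *
      jacobiTheta₂' ((x / (2 * t) : ℝ) : ℂ) ((π / (2 * t) : ℝ) * Complex.I) := by
  have hpi : (π : ℂ) ≠ 0 := by exact_mod_cast pi_ne_zero
  have htc : (t : ℂ) ≠ 0 := by exact_mod_cast ht.ne'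
  have hI : Complex.I ≠ 0 := Complex.I_ne_zero
  set z : ℂ := Complex.I * x / π with hz
  set τ : ℂ := ((2 * t / π : ℝ) : ℂ) * Complex.I with hτ
  have hτim : 0 < τ.im := by
    rw [hτ, Complex.im_ofReal_mul, Complex.I_im, mul_one]
    positivity
  have hseries : (phi0 x t : ℂ) =
      x * jacobiTheta₂ z τ + t / (π * Complex.I) * jacobiTheta₂' z τ := by
    rw [phi0, Complex.ofReal_tsum]
    refine (tsum_congr fun k => ?_).trans
      (((hasSum_jacobiTheta₂_term z hτim).mul_left (x : ℂ)).add
        ((hasSum_jacobiTheta₂'_term z hτim).mul_left (t / (π * Complex.I)))).tsum_eq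
    have hexp : jacobiTheta₂_term k z τ = Complex.exp (-2 * (k * x + k ^ 2 * t)) := by
      rw [jacobiTheta₂_term, hz, hτ]
      congr 1
      push_cast
      field_simp
      linear_combination ((k : ℂ) * x + k ^ 2 * t) * Complex.I_sq
    rw [jacobiTheta₂'_term, hexp]
    push_cast
    field_simp
  have hzτ : z / τ = ((x / (2 * t) : ℝ) : ℂ) := by
    rw [hz, hτ]
    push_cast
    field_simp
  have hτinv : -1 / τ = (π / (2 * t) : ℝ) * Complex.I := by
    rw [hτ]
    push_cast
    field_simp
    linear_combination -Complex.I_sq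
  have hsqrt : (-Complex.I * τ) ^ (1 / 2 : ℂ) = ((√(2 * t / π) : ℝ) : ℂ) := by
    rw [show -Complex.I * τ = ((2 * t / π : ℝ) : ℂ) by
      rw [hτ]; linear_combination -((2 * t / π : ℝ) : ℂ) * Complex.I_sq, Real.sqrt_eq_rpow,
      Complex.ofReal_cpow (by positivity)]
    norm_num
  have hgauss : -π * Complex.I * z ^ 2 / τ = ((x ^ 2 / (2 * t) : ℝ) : ℂ) := by
    rw [hz, hτ]
    push_cast
    field_simp
    linear_combination -(x : ℂ) ^ 2 * Complex.I_sq
  rw [hseries, jacobiTheta₂_functional_equation, jacobiTheta₂'_functional_equation, hgauss, hsqrt,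
    hzτ, hτinv, hz, hτ]
  have hs : ((√(2 * t / π) : ℝ) : ℂ) ≠ 0 := by
    exact_mod_cast (Real.sqrt_pos.mpr (by positivity)).ne'
  push_cast at hs ⊢
  field_simp
  ring_nf
  simp only [Complex.I_sq]
  ring

/-- As the modulus tends to `i∞`, the `n = ±1` terms dominate the theta derivative. -/
lemma tendsto_exp_mul_jacobiTheta₂' {α : Type*} {l : Filter α} {w s : α → ℝ} {w₀ : ℝ}
    (hw : Tendsto w l (nhds w₀)) (hs : Tendsto s l atTop) :
    Tendsto (fun i => (Real.exp (π * s i) : ℂ) * jacobiTheta₂' (w i) (s i * Complex.I)) l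
      (nhds ((-(4 * π * Real.sin (2 * π * w₀)) : ℝ) : ℂ)) := by
  let g : ℤ → ℂ := fun n => if n = 1 ∨ n = -1 then
    2 * π * Complex.I * n * Complex.exp (2 * π * Complex.I * n * w₀) else 0
  have hg : ∑' n, g n = ((-(4 * π * Real.sin (2 * π * w₀)) : ℝ) : ℂ) := by
    rw [tsum_eq_sum (s := ({1, -1} : Finset ℤ)) (by intro n hn; simp_all [g]),
      Finset.sum_pair (by norm_num)]
    simp only [g]
    push_cast
    rw [Complex.sin]
    norm_num
    ring_nf
  rw [← hg]
  have hterm (n : ℤ) (i : α) : (Real.exp (π * s i) : ℂ) *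
      jacobiTheta₂'_term n (w i) (s i * Complex.I) =
      2 * π * Complex.I * n * Complex.exp (2 * π * Complex.I * n * w i) *
        (Real.exp (-(π * (n ^ 2 - 1)) * s i) : ℂ) := by
    rw [jacobiTheta₂'_term, jacobiTheta₂_term, Complex.exp_add]
    have : Complex.exp (π * Complex.I * n ^ 2 * (s i * Complex.I)) * (Real.exp (π * s i) : ℂ) =
        (Real.exp (-(π * (n ^ 2 - 1)) * s i) : ℂ) := by
      push_cast
      rw [← Complex.exp_add]
      congr 1
      linear_combination π * (n : ℂ) ^ 2 * s i * Complex.I_sq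
    rw [← this]
    ring
  simp_rw [jacobiTheta₂', ← tsum_mul_left, hterm]
  have hbd : Summable fun n : ℤ => 2 * π * Real.exp π *
      ((|n| ^ 1 : ℝ) * Real.exp (-π * (1 * n ^ 2 - 2 * 0 * |n|))) :=
    (summable_pow_mul_jacobiTheta₂_term_bound 0 one_pos 1).mul_left _
  have hnsq {n : ℤ} (hn : n ≠ 0) : (1 : ℝ) ≤ n ^ 2 := by
    exact_mod_cast (by have := sq_pos_of_ne_zero hn; omega : (1 : ℤ) ≤ n ^ 2)
  refine tendsto_tsum_of_dominated_convergence hbd (fun n => ?_) ?_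
  · have hE : Tendsto (fun i => 2 * π * Complex.I * n * Complex.exp (2 * π * Complex.I * n * w i)) l
        (nhds (2 * π * Complex.I * n * Complex.exp (2 * π * Complex.I * n * w₀))) :=
      ((by fun_prop : Continuous fun v : ℝ => 2 * π * Complex.I * n *
        Complex.exp (2 * π * Complex.I * n * v)).tendsto w₀).comp hw
    by_cases h0 : n = 0
    · simp [h0, g, tendsto_const_nhds]
    by_cases h1 : n = 1 ∨ n = -1
    · have hsq : (n : ℝ) ^ 2 = 1 := by rcases h1 with rfl | rfl <;> norm_num
      simpa [g, h1, hsq] using hE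
    · have hgt : 0 < π * ((n : ℝ) ^ 2 - 1) := by
        refine mul_pos pi_pos (sub_pos.mpr (lt_of_le_of_ne (hnsq h0) fun h => h1 ?_))
        exact mul_self_eq_one_iff.mp (by rw [← sq]; exact_mod_cast h.symm)
      have hlim : Tendsto (fun i => (Real.exp (-(π * (n ^ 2 - 1)) * s i) : ℂ)) l (nhds 0) := by
        rw [← Complex.ofReal_zero]
        refine (Complex.continuous_ofReal.tendsto 0).comp (Real.tendsto_exp_atBot.comp ?_)
        exact hs.const_mul_atTop_of_neg (by linarith)
      simpa [g, h1] using hE.mul hlim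
  · filter_upwards [hs.eventually_ge_atTop 1] with i hi n
    have hnorm : ‖Complex.exp (2 * π * Complex.I * n * w i)‖ = 1 := by
      rw [show 2 * π * Complex.I * n * w i = ((2 * π * n * w i : ℝ) : ℂ) * Complex.I by
        push_cast; ring, Complex.norm_exp_ofReal_mul_I]
    rw [norm_mul, norm_mul, hnorm, Complex.norm_real, Real.norm_of_nonneg (Real.exp_pos _).le]
    by_cases h0 : n = 0
    · simp [h0]
    have hexp : Real.exp (-(π * (n ^ 2 - 1)) * s i) ≤ Real.exp π * Real.exp (-π * n ^ 2) := by
      rw [← Real.exp_add, Real.exp_le_exp]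
      nlinarith [mul_nonneg (mul_nonneg pi_pos.le (sub_nonneg.mpr (hnsq h0))) (sub_nonneg.mpr hi)]
    have hc : ‖(2 * π * Complex.I * n : ℂ)‖ = 2 * π * |(n : ℝ)| := by
      simp [abs_of_pos pi_pos]
    rw [hc, mul_one]
    calc _ ≤ 2 * π * |(n : ℝ)| * (Real.exp π * Real.exp (-π * n ^ 2)) := by gcongr
      _ = _ := by simp; ring

/-- The `n = ±1` size of `phi0` after Poisson summation. -/
noncomputable def phi0Scale (x t : ℝ) : ℝ :=
  -(1 / 2) * ((√(2 * t / π))⁻¹ * Real.exp (x ^ 2 / (2 * t) - π * (π / (2 * t))))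

lemma phi0Scale_ne_zero (x : ℝ) {t : ℝ} (ht : 0 < t) : phi0Scale x t ≠ 0 := by
  have : √(2 * t / π) ≠ 0 := (Real.sqrt_pos.mpr (by positivity)).ne'
  simp [phi0Scale, this, Real.exp_ne_zero]

lemma phi0_eq_phi0Scale_mul (x : ℝ) {t : ℝ} (ht : 0 < t) :
    phi0 x t = phi0Scale x t * ((Real.exp (π * (π / (2 * t))) : ℂ) *
      jacobiTheta₂' ((x / (2 * t) : ℝ) : ℂ) ((π / (2 * t) : ℝ) * Complex.I)).re := by
  rw [← Complex.ofReal_re (phi0 x t), ofReal_phi0_eq_jacobiTheta₂' x ht, Complex.re_ofReal_mul,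
    Complex.re_ofReal_mul, phi0Scale, Real.exp_sub]
  field_simp

/-- `phi0` divided by its scale factor converges to a sine along parabolic scalings. -/
lemma tendsto_phi0_div_phi0Scale {u : ℝ} (hu : 0 < u) (y : ℝ) {t : ℝ} (ht : 0 ≤ t) :
    Tendsto (fun c : ℝ => phi0 (c * y) (c ^ 2 * t + c * u) / phi0Scale (c * y) (c ^ 2 * t + c * u))
      (nhdsWithin 0 (Set.Ioi 0)) (nhds (-(4 * π * Real.sin (π * y / u)))) := by
  have hw : Tendsto (fun c : ℝ => c * y / (2 * (c ^ 2 * t + c * u))) (nhdsWithin 0 (Set.Ioi 0))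
      (nhds (y / (2 * u))) := by
    have : Tendsto (fun c : ℝ => y / (2 * (c * t + u))) (nhdsWithin 0 (Set.Ioi 0))
        (nhds (y / (2 * (0 * t + u)))) :=
      (ContinuousAt.tendsto (by fun_prop (disch := simp; positivity))).mono_left
        nhdsWithin_le_nhds
    rw [zero_mul, zero_add] at this
    refine this.congr' ?_
    filter_upwards [self_mem_nhdsWithin] with c hc
    have hc : 0 < c := hc
    field_simp
  have hs : Tendsto (fun c : ℝ => π / (2 * (c ^ 2 * t + c * u))) (nhdsWithin 0 (Set.Ioi 0))
      atTop := by
    refine Tendsto.const_mul_atTop pi_pos (tendsto_inv_nhdsGT_zero.comp ?_)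
    refine tendsto_nhdsWithin_iff.mpr ⟨?_, ?_⟩
    · have : Tendsto (fun c : ℝ => 2 * (c ^ 2 * t + c * u)) (nhds 0)
          (nhds (2 * (0 ^ 2 * t + 0 * u))) := Continuous.tendsto (by fun_prop) 0
      simpa using this.mono_left nhdsWithin_le_nhds
    · filter_upwards [self_mem_nhdsWithin] with c hc
      have hc : 0 < c := hc
      exact Set.mem_Ioi.mpr (by positivity)
  have h := (Complex.continuous_re.tendsto _).comp (tendsto_exp_mul_jacobiTheta₂' hw hs)
  rw [Complex.ofReal_re, show 2 * π * (y / (2 * u)) = π * y / u by field_simp] at h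
  refine h.congr' ?_
  filter_upwards [self_mem_nhdsWithin] with c hc
  have hc : 0 < c := hc
  have hT : 0 < c ^ 2 * t + c * u := by positivity
  rw [phi0_eq_phi0Scale_mul _ hT, mul_div_cancel_left₀ _ (phi0Scale_ne_zero _ hT)]
  rfl

lemma tendsto_phi0Scale_div {u : ℝ} (hu : 0 < u) (x y : ℝ) {t : ℝ} (ht : 0 ≤ t) :
    Tendsto (fun c : ℝ => phi0Scale (c * y) (c ^ 2 * t + c * u) / phi0Scale (c * x) (c * u))
      (nhdsWithin 0 (Set.Ioi 0)) (nhds (Real.exp (π ^ 2 * t / (2 * u ^ 2)))) := by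
  have h : Tendsto (fun c : ℝ => √(u / (c * t + u)) * Real.exp (c * y ^ 2 / (2 * (c * t + u)) -
      c * x ^ 2 / (2 * u) + π ^ 2 * t / (2 * u * (c * t + u)))) (nhdsWithin 0 (Set.Ioi 0))
      (nhds (√(u / (0 * t + u)) * Real.exp (0 * y ^ 2 / (2 * (0 * t + u)) -
      0 * x ^ 2 / (2 * u) + π ^ 2 * t / (2 * u * (0 * t + u))))) :=
    (ContinuousAt.tendsto (by fun_prop (disch := simp; positivity))).mono_left nhdsWithin_le_nhds
  have hval : √(u / (0 * t + u)) * Real.exp (0 * y ^ 2 / (2 * (0 * t + u)) -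
      0 * x ^ 2 / (2 * u) + π ^ 2 * t / (2 * u * (0 * t + u))) =
      Real.exp (π ^ 2 * t / (2 * u ^ 2)) := by
    simp [hu.ne', mul_assoc, sq]
  rw [hval] at h
  refine h.congr' ?_
  filter_upwards [self_mem_nhdsWithin] with c hc
  have hc : 0 < c := hc
  have hsqrt : √(u / (c * t + u)) =
      (√(2 * (c ^ 2 * t + c * u) / π))⁻¹ / (√(2 * (c * u) / π))⁻¹ := by
    rw [inv_div_inv, ← Real.sqrt_div (by positivity)]
    congr 1
    field_simp
  have hexp : c * y ^ 2 / (2 * (c * t + u)) - c * x ^ 2 / (2 * u) +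
      π ^ 2 * t / (2 * u * (c * t + u)) =
      ((c * y) ^ 2 / (2 * (c ^ 2 * t + c * u)) - π * (π / (2 * (c ^ 2 * t + c * u)))) -
      ((c * x) ^ 2 / (2 * (c * u)) - π * (π / (2 * (c * u)))) := by
    field_simp
    ring
  rw [hexp, hsqrt, phi0Scale, phi0Scale, mul_div_mul_left _ _ (by norm_num), mul_div_mul_comm,
    Real.exp_sub (_ - _)]

/-- Let `u > 0`, `0 < x < u`, `0 ≤ y ≤ u`, `t > 0`. Then as `c → 0⁺`,
`φ_0(cy, c²t + cu) / φ_0(cx, cu) → (sin(πy/u)/sin(πx/u)) · exp(π²t/(2u²))`; equivalently, with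
`φ_0^{(c)}(z,s) = φ_0(cz, c²s)`, one has
`φ_0^{(c)}(y, t + u/c) / φ_0^{(c)}(x, u/c) → (sin(πy/u)/sin(πx/u)) · exp(π²t/(2u²))`. -/
theorem phi0_scaling_limit (u x y t : ℝ) (hu : 0 < u) (hx : 0 < x) (hxu : x < u)
    (hy : 0 ≤ y) (hyu : y ≤ u) (ht : 0 < t) :
    Tendsto (fun c : ℝ => phi0 (c * y) (c ^ 2 * t + c * u) / phi0 (c * x) (c * u))
      (nhdsWithin 0 (Set.Ioi (0 : ℝ)))
      (nhds ((Real.sin (Real.pi * y / u) / Real.sin (Real.pi * x / u)) *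
        Real.exp (Real.pi ^ 2 * t / (2 * u ^ 2)))) := by
  have hden := tendsto_phi0_div_phi0Scale hu x le_rfl
  simp only [mul_zero, zero_add] at hden
  have hsin : 0 < Real.sin (π * x / u) := by
    refine Real.sin_pos_of_pos_of_lt_pi (by positivity) ?_
    rw [div_lt_iff₀ hu]
    exact mul_lt_mul_of_pos_left hxu pi_pos
  have hne : -(4 * π * Real.sin (π * x / u)) ≠ 0 := neg_ne_zero.mpr (by positivity)
  have h := ((tendsto_phi0_div_phi0Scale hu y ht.le).div hden hne).mul
    (tendsto_phi0Scale_div hu x y ht.le)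
  rw [neg_div_neg_eq, mul_div_mul_left _ _ (by positivity)] at h
  refine h.congr' ?_
  filter_upwards [self_mem_nhdsWithin] with c hc
  have hc : 0 < c := hc
  have h₁ := phi0Scale_ne_zero (c * y) (by positivity : 0 < c ^ 2 * t + c * u)
  have h₂ := phi0Scale_ne_zero (c * x) (by positivity : 0 < c * u)
  simp only [Pi.div_apply]
  rw [← mul_div_mul_comm, div_mul_cancel₀ _ h₁, div_mul_cancel₀ _ h₂]
end
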